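/- For every real r > 0, every matchstick graph on n vertices all of whose vertices (and hence all of whose edge segments) are contained in a closed disk of radius r has at most (2 - 1/(20·3^(16r²)))·n + 100r⁴ + 8r² edges. (Explicit form of the upper bound of Theorem 3, as established in the proof.) -/

import Mathlib

/-- A *matchstick embedding* (drawing) of a simple graph `G`: the vertices are
represented by distinct points of the Euclidean plane, every edge is a
straight-line segment of unit length, two segments representing distinct edges
intersect in at most a common endpoint, and no vertex point lies in the
relative interior (open segment) of any edge segment. A graph admitting such an
embedding is a *matchstick graph*. -/
structure MatchstickEmbedding {V : Type*} (G : SimpleGraph V) where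
  /-- the position of each vertex in the plane -/
  pos : V → EuclideanSpace ℝ (Fin 2)
  /-- the vertex points are distinct -/
  inj : Function.Injective pos
  /-- every edge has unit length -/
  unit : ∀ u v : V, G.Adj u v → dist (pos u) (pos v) = 1
  /-- no vertex lies in the relative interior of an edge segment -/
  noVertexInterior : ∀ w u v : V, G.Adj u v → pos w ∉ openSegment ℝ (pos u) (pos v)
  /-- segments of distinct edges intersect in at most a common endpoint -/
  noncross : ∀ u v a b : V, G.Adj u v → G.Adj a b → s(u, v) ≠ s(a, b) →
    segment ℝ (pos u) (pos v) ∩ segment ℝ (pos a) (pos b) ⊆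
      ({pos u, pos v} ∩ {pos a, pos b} : Set (EuclideanSpace ℝ (Fin 2)))

/-- A straight-line unit-edge drawing in coordinates, with distinct abscissas. -/
structure Cfg (V : Type*) where
  G : SimpleGraph V
  x : V → ℝ
  y : V → ℝ
  xinj : Function.Injective x
  unit : ∀ u v, G.Adj u v → (x v - x u) ^ 2 + (y v - y u) ^ 2 = 1
  noint : ∀ w u v, G.Adj u v → ∀ t : ℝ, 0 < t → t < 1 →
    x w = x u + t * (x v - x u) → y w = y u + t * (y v - y u) → False
  nocross : ∀ u v a b, G.Adj u v → G.Adj a b → s(u, v) ≠ s(a, b) →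
    ∀ t s : ℝ, 0 ≤ t → t ≤ 1 → 0 ≤ s → s ≤ 1 →
    x u + t * (x v - x u) = x a + s * (x b - x a) →
    y u + t * (y v - y u) = y a + s * (y b - y a) → (t = 0 ∨ t = 1) ∧ (s = 0 ∨ s = 1)

namespace Cfg
variable {V : Type*} (c : Cfg V)

/-- reflection in the vertical axis -/
def mx : Cfg V where
  G := c.G
  x := fun v => - c.x v
  y := c.y
  xinj := fun a b h => c.xinj (by simpa using h)
  unit := fun u v h => by have := c.unit u v h; nlinarith
  noint := fun w u v h t h0 h1 hx hy => c.noint w u v h t h0 h1 (by linarith) hy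
  nocross := fun u v a b h1 h2 h3 t s a1 a2 a3 a4 hx hy =>
    c.nocross u v a b h1 h2 h3 t s a1 a2 a3 a4 (by linarith) hy

/-- reflection in the horizontal axis -/
def my : Cfg V where
  G := c.G
  x := c.x
  y := fun v => - c.y v
  xinj := c.xinj
  unit := fun u v h => by have := c.unit u v h; nlinarith
  noint := fun w u v h t h0 h1 hx hy => c.noint w u v h t h0 h1 hx (by linarith)
  nocross := fun u v a b h1 h2 h3 t s a1 a2 a3 a4 hx hy =>
    c.nocross u v a b h1 h2 h3 t s a1 a2 a3 a4 hx (by linarith)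

/-- right-going edge -/
def E (a b : V) : Prop := c.G.Adj a b ∧ c.x a < c.x b

/-- height of the line through an edge -/
noncomputable def h (p q : V) (t : ℝ) : ℝ :=
  c.y p + (t - c.x p) / (c.x q - c.x p) * (c.y q - c.y p)

/-- `a` is the top left neighbour of `b` -/
def lu (a b : V) : Prop := c.E a b ∧ ∀ d, c.E d b → c.y d ≤ c.y a
/-- `b` is the top right neighbour of `a` -/
def ru (a b : V) : Prop := c.E a b ∧ ∀ d, c.E a d → c.y d ≤ c.y b
/-- `a` is the bottom left neighbour of `b` -/
def ld (a b : V) : Prop := c.E a b ∧ ∀ d, c.E d b → c.y a ≤ c.y d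
/-- `b` is the bottom right neighbour of `a` -/
def rd (a b : V) : Prop := c.E a b ∧ ∀ d, c.E a d → c.y b ≤ c.y d
/-- `a` is the right neighbour of `s` next above `b` -/
def nxtR (s b a : V) : Prop :=
  c.E s b ∧ c.E s a ∧ c.y b < c.y a ∧ ∀ d, c.E s d → ¬ (c.y b < c.y d ∧ c.y d < c.y a)
/-- `a` is the left neighbour of `s` next above `b` -/
def nxtL (s b a : V) : Prop :=
  c.E b s ∧ c.E a s ∧ c.y b < c.y a ∧ ∀ d, c.E d s → ¬ (c.y b < c.y d ∧ c.y d < c.y a)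
/-- the edge `p q` is directly above the point `(zx, zy)` -/
def DA (zx zy : ℝ) (p q : V) : Prop :=
  c.E p q ∧ c.x p < zx ∧ zx < c.x q ∧ zy < c.h p q zx ∧
  ∀ p' q', c.E p' q' → c.x p' < zx → zx < c.x q' → zy < c.h p' q' zx → c.h p q zx ≤ c.h p' q' zx
/-- the edge `p q` is directly below the point `(zx, zy)` -/
def DB (zx zy : ℝ) (p q : V) : Prop :=
  c.E p q ∧ c.x p < zx ∧ zx < c.x q ∧ c.h p q zx < zy ∧
  ∀ p' q', c.E p' q' → c.x p' < zx → zx < c.x q' → c.h p' q' zx < zy → c.h p' q' zx ≤ c.h p q zx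

variable {c}

lemma E.lt {a b : V} (h : c.E a b) : c.x a < c.x b := h.2
lemma E.sq {a b : V} (h : c.E a b) : (c.x b - c.x a) ^ 2 + (c.y b - c.y a) ^ 2 = 1 := c.unit _ _ h.1

lemma h_left {p q : V} : c.h p q (c.x p) = c.y p := by simp [h]
lemma h_right {p q : V} (e : c.E p q) : c.h p q (c.x q) = c.y q := by
  have := e.lt
  rw [h, div_self (by linarith)]; ring

lemma vtx_ne {p q w : V} (e : c.E p q) (h1 : c.x p < c.x w) (h2 : c.x w < c.x q) :
    c.y w ≠ c.h p q (c.x w) := by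
  intro hh
  have := e.lt
  refine c.noint w p q e.1 ((c.x w - c.x p) / (c.x q - c.x p)) ?_ ?_ ?_ hh
  · apply div_pos <;> linarith
  · rw [div_lt_one] <;> linarith
  · field_simp [show c.x q - c.x p ≠ 0 by linarith]; ring

lemma cross_pt {p q p' q' : V} (e : c.E p q) (e' : c.E p' q') (hne : (p, q) ≠ (p', q')) {t : ℝ}
    (h1 : c.x p ≤ t) (h2 : t ≤ c.x q) (h3 : c.x p' ≤ t) (h4 : t ≤ c.x q')
    (hh : c.h p q t = c.h p' q' t) :
    (t = c.x p ∨ t = c.x q) ∧ (t = c.x p' ∨ t = c.x q') := by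
  have l := e.lt
  have l' := e'.lt
  have key := c.nocross p q p' q' e.1 e'.1 (by
    intro hs
    rcases Sym2.eq_iff.1 hs with ⟨rfl, rfl⟩ | ⟨rfl, rfl⟩
    · exact hne rfl
    · linarith) ((t - c.x p) / (c.x q - c.x p)) ((t - c.x p') / (c.x q' - c.x p'))
    (div_nonneg (by linarith) (by linarith)) ((div_le_one (by linarith)).2 (by linarith))
    (div_nonneg (by linarith) (by linarith)) ((div_le_one (by linarith)).2 (by linarith))
    (by
      rw [div_mul_cancel₀ _ (by linarith), div_mul_cancel₀ _ (by linarith)]; ring) hh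
  have n1 : c.x q - c.x p ≠ 0 := by linarith
  have n2 : c.x q' - c.x p' ≠ 0 := by linarith
  rw [div_eq_zero_iff, div_eq_one_iff_eq n1, div_eq_zero_iff, div_eq_one_iff_eq n2] at key
  obtain ⟨k1, k2⟩ := key
  constructor
  · rcases k1 with (k | k) | k
    · left; linarith
    · exact absurd k n1
    · right; linarith
  · rcases k2 with (k | k) | k
    · left; linarith
    · exact absurd k n2
    · right; linarith

lemma h_affine (p q : V) (s t u : ℝ) : c.h p q (s + u * (t - s)) =
    (1 - u) * c.h p q s + u * c.h p q t := by
  simp only [h, div_eq_mul_inv]; ring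

/-- two edges keep their vertical order -/
lemma order_keep {p q p' q' : V} (e : c.E p q) (e' : c.E p' q') {t1 t2 : ℝ}
    (h1 : c.x p ≤ t1) (h2 : t1 ≤ c.x q) (h3 : c.x p' ≤ t1) (h4 : t1 ≤ c.x q')
    (g1 : c.x p ≤ t2) (g2 : t2 ≤ c.x q) (g3 : c.x p' ≤ t2) (g4 : t2 ≤ c.x q')
    (hlt : c.h p q t1 < c.h p' q' t1) : c.h p q t2 ≤ c.h p' q' t2 := by
  by_contra hcon
  push Not at hcon
  have hne : (p, q) ≠ (p', q') := by
    rintro hh; simp only [Prod.mk.injEq] at hh; obtain ⟨rfl, rfl⟩ := hh; exact lt_irrefl _ hlt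
  set A := c.h p' q' t1 - c.h p q t1 with hA
  set B := c.h p q t2 - c.h p' q' t2 with hB
  have hA0 : 0 < A := by rw [hA]; linarith
  have hB0 : 0 < B := by rw [hB]; linarith
  have hu0 : 0 < A / (A + B) := by positivity
  have hu1 : A / (A + B) < 1 := by rw [div_lt_one (by linarith)]; linarith
  have heq : c.h p q (t1 + A / (A + B) * (t2 - t1)) = c.h p' q' (t1 + A / (A + B) * (t2 - t1)) := by
    rw [h_affine, h_affine]
    have : A / (A + B) * (A + B) = A := by field_simp
    have e1 : c.h p' q' t1 = A + c.h p q t1 := by rw [hA]; ring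
    have e2 : c.h p q t2 = B + c.h p' q' t2 := by rw [hB]; ring
    rw [e1, e2]; linear_combination this
  have tne : t1 ≠ t2 := by rintro rfl; linarith
  set u := A / (A + B)
  have b1 : min t1 t2 < t1 + u * (t2 - t1) ∧ t1 + u * (t2 - t1) < max t1 t2 := by
    rcases lt_or_gt_of_ne tne with hl | hl
    · rw [min_eq_left hl.le, max_eq_right hl.le]; constructor <;> nlinarith
    · rw [min_eq_right hl.le, max_eq_left hl.le]; constructor <;> nlinarith
  have m1 : c.x p ≤ min t1 t2 := le_min h1 g1
  have m2 : max t1 t2 ≤ c.x q := max_le h2 g2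
  have m3 : c.x p' ≤ min t1 t2 := le_min h3 g3
  have m4 : max t1 t2 ≤ c.x q' := max_le h4 g4
  have := (cross_pt e e' hne (by linarith) (by linarith) (by linarith) (by linarith) heq).1
  rcases this with h | h <;> linarith

/-- strict version, at a point interior to one of the two edges -/
lemma order_keep_lt {p q p' q' : V} (e : c.E p q) (e' : c.E p' q') {t1 t2 : ℝ}
    (h1 : c.x p ≤ t1) (h2 : t1 ≤ c.x q) (h3 : c.x p' ≤ t1) (h4 : t1 ≤ c.x q')
    (g1 : c.x p ≤ t2) (g2 : t2 ≤ c.x q) (g3 : c.x p' ≤ t2) (g4 : t2 ≤ c.x q')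
    (hi : (c.x p < t2 ∧ t2 < c.x q) ∨ (c.x p' < t2 ∧ t2 < c.x q'))
    (hlt : c.h p q t1 < c.h p' q' t1) : c.h p q t2 < c.h p' q' t2 := by
  have hne : (p, q) ≠ (p', q') := by
    rintro hh; simp only [Prod.mk.injEq] at hh; obtain ⟨rfl, rfl⟩ := hh; exact lt_irrefl _ hlt
  refine lt_of_le_of_ne (order_keep e e' h1 h2 h3 h4 g1 g2 g3 g4 hlt) fun heq => ?_
  have := cross_pt e e' hne g1 g2 g3 g4 heq
  rcases hi with hi | hi
  · rcases this.1 with h | h <;> linarith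
  · rcases this.2 with h | h <;> linarith

lemma DA_unique {zx zy : ℝ} {p q p' q' : V} (h1 : c.DA zx zy p q) (h2 : c.DA zx zy p' q') :
    p = p' ∧ q = q' := by
  obtain ⟨e, a1, a2, a3, a4⟩ := h1
  obtain ⟨e', b1, b2, b3, b4⟩ := h2
  by_contra hne
  have hh := le_antisymm (a4 _ _ e' b1 b2 b3) (b4 _ _ e a1 a2 a3)
  have := (cross_pt e e' (by simpa [Prod.ext_iff] using hne) a1.le a2.le b1.le b2.le hh).1
  rcases this with h | h <;> linarith

/-! ### mirror translations -/

lemma E_mx {a b : V} : c.mx.E a b ↔ c.E b a := by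
  simp [E, mx, c.G.adj_comm a b]
lemma E_my {a b : V} : c.my.E a b ↔ c.E a b := Iff.rfl

lemma y_my (v : V) : c.my.y v = - c.y v := rfl
lemma x_my (v : V) : c.my.x v = c.x v := rfl
lemma y_mx (v : V) : c.mx.y v = c.y v := rfl
lemma x_mx (v : V) : c.mx.x v = - c.x v := rfl

lemma h_my (p q : V) (t : ℝ) : c.my.h p q t = - c.h p q t := by
  simp only [h, my]; ring
lemma h_mx {p q : V} (e : c.E p q) (t : ℝ) : c.mx.h q p t = c.h p q (-t) := by
  have := e.lt
  have h1 : c.x q - c.x p ≠ 0 := by linarith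
  have h2 : -c.x p - -c.x q ≠ 0 := by linarith
  simp only [h, mx]
  field_simp
  ring

lemma lu_mx {a b : V} : c.mx.lu a b ↔ c.ru b a := by
  simp only [lu, ru, E_mx]; rfl
lemma ru_mx {a b : V} : c.mx.ru a b ↔ c.lu b a := by
  simp only [lu, ru, E_mx]; rfl
lemma lu_my {a b : V} : c.my.lu a b ↔ c.ld a b := by
  simp only [lu, ld, E_my, y_my, neg_le_neg_iff]
lemma ld_my {a b : V} : c.my.ld a b ↔ c.lu a b := by
  simp only [lu, ld, E_my, y_my, neg_le_neg_iff]
lemma ru_my {a b : V} : c.my.ru a b ↔ c.rd a b := by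
  simp only [ru, rd, E_my, y_my, neg_le_neg_iff]
lemma rd_my {a b : V} : c.my.rd a b ↔ c.ru a b := by
  simp only [ru, rd, E_my, y_my, neg_le_neg_iff]
lemma nxtR_mx {s b a : V} : c.mx.nxtR s b a ↔ c.nxtL s b a := by
  simp only [nxtR, nxtL, E_mx]; rfl
lemma nxtL_mx {s b a : V} : c.mx.nxtL s b a ↔ c.nxtR s b a := by
  simp only [nxtR, nxtL, E_mx]; rfl
lemma nxtR_my {s b a : V} : c.my.nxtR s b a ↔ c.nxtR s a b := by
  simp only [nxtR, E_my, y_my, neg_lt_neg_iff]; tauto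
lemma nxtL_my {s b a : V} : c.my.nxtL s b a ↔ c.nxtL s a b := by
  simp only [nxtL, E_my, y_my, neg_lt_neg_iff]; tauto

lemma DA_my {zx zy : ℝ} {p q : V} : c.my.DA zx zy p q ↔ c.DB zx (-zy) p q := by
  simp only [DA, DB, E_my, h_my, show c.my.x = c.x from rfl, neg_le_neg_iff]
  simp only [lt_neg]
lemma DB_my {zx zy : ℝ} {p q : V} : c.my.DB zx zy p q ↔ c.DA zx (-zy) p q := by
  simp only [DA, DB, E_my, h_my, show c.my.x = c.x from rfl, neg_le_neg_iff]
  simp only [neg_lt]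
lemma DA_mx {zx zy : ℝ} {p q : V} : c.mx.DA zx zy p q ↔ c.DA (-zx) zy q p := by
  have hx : c.mx.x = fun v => - c.x v := rfl
  simp only [DA, E_mx, hx]
  constructor
  · rintro ⟨e, a1, a2, a3, a4⟩
    rw [h_mx e] at a3
    refine ⟨e, by linarith, by linarith, a3, fun p' q' e' b1 b2 b3 => ?_⟩
    have := a4 q' p' e' (by linarith) (by linarith) (by rw [h_mx e']; exact b3)
    rwa [h_mx e, h_mx e'] at this
  · rintro ⟨e, a1, a2, a3, a4⟩
    refine ⟨e, by linarith, by linarith, by rwa [h_mx e], fun p' q' e' b1 b2 b3 => ?_⟩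
    rw [h_mx e'] at b3
    rw [h_mx e, h_mx e']
    exact a4 q' p' e' (by linarith) (by linarith) b3
lemma DB_mx {zx zy : ℝ} {p q : V} : c.mx.DB zx zy p q ↔ c.DB (-zx) zy q p := by
  have : c.mx.DB zx zy p q ↔ c.my.mx.DA zx (-zy) p q := by
    rw [show c.my.mx = c.mx.my from rfl, DA_my, neg_neg]
  rw [this, DA_mx, DA_my, neg_neg]
lemma DB_unique {zx zy : ℝ} {p q p' q' : V} (h1 : c.DB zx zy p q) (h2 : c.DB zx zy p' q') :
    p = p' ∧ q = q' :=
  DA_unique (c := c.my) (zx := zx) (zy := -zy) (DA_my.2 (by rwa [neg_neg]))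
    (DA_my.2 (by rwa [neg_neg]))

end Cfg

namespace Cfg
variable {V : Type*} {c : Cfg V}

lemma slope_aux {a b p q : ℝ} (h1 : 0 < a) (h2 : 0 < p) (e1 : a ^ 2 + b ^ 2 = 1)
    (e2 : p ^ 2 + q ^ 2 = 1) (hb : b < q) : 0 < a * q - p * b := by
  rcases le_or_gt 0 b with hb0 | hb0
  · have : p < a := by
      by_contra hh; push Not at hh; nlinarith
    nlinarith
  · rcases le_or_gt 0 q with hq | hq
    · nlinarith [mul_nonneg h1.le hq]
    · have : a < p := by
        by_contra hh; push Not at hh; nlinarith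
      nlinarith

lemma slope_right {s a b : V} (e1 : c.E s b) (e2 : c.E s a) (hy : c.y b < c.y a) {t : ℝ}
    (ht : c.x s < t) : c.h s b t < c.h s a t := by
  have l1 := e1.lt; have l2 := e2.lt
  have := slope_aux (by linarith) (by linarith) e1.sq e2.sq (show c.y b - c.y s < c.y a - c.y s by linarith)
  simp only [h]
  have n1 : 0 < c.x b - c.x s := by linarith
  have n2 : 0 < c.x a - c.x s := by linarith
  have : (c.y b - c.y s) / (c.x b - c.x s) < (c.y a - c.y s) / (c.x a - c.x s) := by
    rw [div_lt_div_iff₀ n1 n2]; linarith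
  have h3 := mul_lt_mul_of_pos_left this (sub_pos.2 ht)
  calc _ = c.y s + (t - c.x s) * ((c.y b - c.y s) / (c.x b - c.x s)) := by ring
    _ < c.y s + (t - c.x s) * ((c.y a - c.y s) / (c.x a - c.x s)) := by linarith
    _ = _ := by ring

lemma slope_left {s a b : V} (e1 : c.E b s) (e2 : c.E a s) (hy : c.y b < c.y a) {t : ℝ}
    (ht : t < c.x s) : c.h b s t < c.h a s t := by
  have := slope_right (c := c.mx) (E_mx.2 e1) (E_mx.2 e2) hy (t := -t)
    (by rw [x_mx]; linarith)
  rwa [h_mx e1, h_mx e2, neg_neg] at this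

lemma right_inj {s a b : V} (e1 : c.E s a) (e2 : c.E s b) (hy : c.y a = c.y b) : a = b := by
  have l := e1.sq; have l' := e2.sq; have h1 := e1.lt; have h2 := e2.lt
  rw [hy] at l
  apply c.xinj
  have : (c.x a - c.x s) ^ 2 = (c.x b - c.x s) ^ 2 := by linarith
  have := (sq_eq_sq₀ (by linarith) (by linarith)).1 this
  linarith

lemma left_inj {s a b : V} (e1 : c.E a s) (e2 : c.E b s) (hy : c.y a = c.y b) : a = b :=
  right_inj (c := c.mx) (E_mx.2 e1) (E_mx.2 e2) hy

/-- two edges `p q`, `p' q'`, bounding a region to the right of the line `x = x0`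
which no edge enters from the left -/
structure Gap (c : Cfg V) (p q p' q' : V) (x0 : ℝ) : Prop where
  e : c.E p q
  e' : c.E p' q'
  l1 : c.x p ≤ x0
  l1' : c.x p' ≤ x0
  l2 : x0 < c.x q
  l2' : x0 < c.x q'
  lt : ∀ t, x0 < t → t < c.x q → t < c.x q' → c.h p q t < c.h p' q' t
  blk : ∀ u v, c.E u v → c.x u ≤ x0 → ∀ t, x0 < t → t ≤ c.x v → t ≤ c.x q → t ≤ c.x q' →
    ¬ (c.h p q t < c.h u v t ∧ c.h u v t < c.h p' q' t)

/-- no vertex strictly between the two edges, with abscissa in `(x0, xe)` -/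
def NoV (c : Cfg V) (p q p' q' : V) (x0 xe : ℝ) : Prop :=
  ∀ w, x0 < c.x w → c.x w < xe → ¬ (c.h p q (c.x w) < c.y w ∧ c.y w < c.h p' q' (c.x w))

lemma Gap.tomy {p q p' q' : V} {x0 : ℝ} (g : c.Gap p q p' q' x0) : c.my.Gap p' q' p q x0 where
  e := g.e'
  e' := g.e
  l1 := g.l1'
  l1' := g.l1
  l2 := g.l2'
  l2' := g.l2
  lt := fun t h1 h2 h3 => by
    rw [h_my, h_my]; exact neg_lt_neg (g.lt t h1 h3 h2)
  blk := fun u v e h0 t h1 h2 h3 h4 => by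
    rw [h_my, h_my, h_my]
    rintro ⟨a1, a2⟩
    exact g.blk u v e h0 t h1 h2 h4 h3 ⟨by linarith, by linarith⟩

lemma NoV.tomy {p q p' q' : V} {x0 xe : ℝ} (g : c.NoV p q p' q' x0 xe) :
    c.my.NoV p' q' p q x0 xe := by
  intro w h1 h2
  rw [h_my, h_my, y_my, x_my]
  rintro ⟨a1, a2⟩
  exact g w h1 h2 ⟨by simpa using a2, by simpa using a1⟩

lemma NoV_my {p q p' q' : V} {x0 xe : ℝ} :
    c.my.NoV p' q' p q x0 xe ↔ c.NoV p q p' q' x0 xe :=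
  ⟨fun h => by simpa [my] using h.tomy, fun h => h.tomy⟩

lemma NoV_mono {p q p' q' : V} {x0 xe xf : ℝ} (g : c.NoV p q p' q' x0 xe) (hx : xf ≤ xe) :
    c.NoV p q p' q' x0 xf := fun w h1 h2 => g w h1 (h2.trans_le hx)

lemma Gap.noedge {p q p' q' : V} {x0 xe : ℝ} (g : c.Gap p q p' q' x0)
    (n : c.NoV p q p' q' x0 xe) (b1 : xe ≤ c.x q) (b2 : xe ≤ c.x q') {u v : V} (e : c.E u v)
    {t : ℝ} (h0 : x0 < t) (h1 : t ≤ xe) (h2 : c.x u < t) (h3 : t ≤ c.x v) :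
    ¬ (c.h p q t < c.h u v t ∧ c.h u v t < c.h p' q' t) := by
  rintro ⟨k1, k2⟩
  have l := g.l1; have l' := g.l1'
  rcases le_or_gt (c.x u) x0 with hu | hu
  · exact g.blk u v e hu t h0 h3 (by linarith) (by linarith) ⟨k1, k2⟩
  · have e1 := e.lt
    refine n u hu (by linarith) ⟨?_, ?_⟩
    · have := order_keep_lt g.e e (t1 := t) (t2 := c.x u) (by linarith) (by linarith) (by linarith)
        (by linarith) (by linarith) (by linarith) le_rfl (by linarith)
        (Or.inl ⟨by linarith, by linarith⟩) k1
      rwa [h_left] at this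
    · have := order_keep_lt e g.e' (t1 := t) (t2 := c.x u) (by linarith) (by linarith) (by linarith)
        (by linarith) (by linarith) (by linarith) (by linarith) (by linarith)
        (Or.inr ⟨by linarith, by linarith⟩) k2
      rwa [h_left] at this

lemma Gap.DA {p q p' q' : V} {x0 xe : ℝ} (g : c.Gap p q p' q' x0)
    (n : c.NoV p q p' q' x0 xe) (b1 : xe ≤ c.x q) (b2 : xe ≤ c.x q') {zx zy : ℝ}
    (h0 : x0 < zx) (h1 : zx ≤ xe) (h2 : zx < c.x q') (h3 : c.h p q zx ≤ zy)
    (h4 : zy < c.h p' q' zx) : c.DA zx zy p' q' := by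
  have l := g.l1; have l' := g.l1'
  refine ⟨g.e', by linarith, h2, h4, fun u v e k1 k2 k3 => ?_⟩
  by_contra hh
  push Not at hh
  exact g.noedge n b1 b2 e h0 h1 k1 k2.le ⟨by linarith, hh⟩

lemma Gap.DB {p q p' q' : V} {x0 xe : ℝ} (g : c.Gap p q p' q' x0)
    (n : c.NoV p q p' q' x0 xe) (b1 : xe ≤ c.x q) (b2 : xe ≤ c.x q') {zx zy : ℝ}
    (h0 : x0 < zx) (h1 : zx ≤ xe) (h2 : zx < c.x q) (h3 : c.h p q zx < zy)
    (h4 : zy ≤ c.h p' q' zx) : c.DB zx zy p q := by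
  have := g.tomy.DA n.tomy b2 b1 (zy := -zy) h0 h1 h2 (by rw [h_my]; linarith)
    (by rw [h_my]; linarith)
  rwa [DA_my, neg_neg] at this

lemma Gap.lt_end {p q p' q' : V} {x0 : ℝ} (g : c.Gap p q p' q' x0) (hx : c.x q < c.x q') :
    c.y q < c.h p' q' (c.x q) := by
  have l := g.l1; have l' := g.l1'; have l2 := g.l2
  have k := g.lt ((x0 + c.x q) / 2) (by linarith) (by linarith) (by linarith)
  have := order_keep_lt g.e g.e' (t1 := (x0 + c.x q) / 2) (t2 := c.x q) (by linarith) (by linarith)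
    (by linarith) (by linarith) (by linarith) (by linarith) (by linarith) (by linarith)
    (Or.inr ⟨by linarith, hx⟩) k
  rwa [h_right g.e] at this

lemma Gap.lu {p q p' q' : V} {x0 : ℝ} (g : c.Gap p q p' q' x0)
    (n : c.NoV p q p' q' x0 (c.x q)) (hx : c.x q < c.x q') : c.lu p q := by
  refine ⟨g.e, fun d ed => ?_⟩
  by_contra hy
  push Not at hy
  have l := g.l1; have l' := g.l1'; have l2 := g.l2; have ld := ed.lt
  have : ∃ t, x0 < t ∧ c.x d < t ∧ t < c.x q := by
    refine ⟨(max x0 (c.x d) + c.x q) / 2, ?_, ?_, ?_⟩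
    · linarith [le_max_left x0 (c.x d)]
    · linarith [le_max_right x0 (c.x d)]
    · linarith [max_lt l2 ld]
  obtain ⟨t, t1, t2, t3⟩ := this
  refine g.noedge n le_rfl hx.le ed (t := t) t1 t3.le t2 t3.le ⟨slope_left g.e ed hy t3, ?_⟩
  refine order_keep_lt ed g.e' (t1 := c.x q) ld.le le_rfl (by linarith) hx.le (by linarith)
    (by linarith) (by linarith) (by linarith) (Or.inl ⟨t2, t3⟩) ?_
  rw [h_right ed]
  exact g.lt_end hx

lemma gap_cases [Finite V] {p q p' q' : V} {x0 : ℝ} (g : c.Gap p q p' q' x0) :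
    (∃ w, x0 < c.x w ∧ c.x w < c.x q ∧ c.x w < c.x q' ∧ (∀ u, ¬ c.E u w) ∧
      c.DA (c.x w) (c.y w) p' q' ∧ c.DB (c.x w) (c.y w) p q) ∨
    (c.NoV p q p' q' x0 (min (c.x q) (c.x q')) ∧ (q = q' ∨
      (c.x q < c.x q' ∧ c.lu p q ∧ c.DA (c.x q) (c.y q) p' q') ∨
      (c.x q' < c.x q ∧ c.ld p' q' ∧ c.DB (c.x q') (c.y q') p q))) := by
  classical
  by_cases hn : c.NoV p q p' q' x0 (min (c.x q) (c.x q'))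
  · right
    refine ⟨hn, ?_⟩
    rcases lt_trichotomy (c.x q) (c.x q') with hx | hx | hx
    · right; left
      rw [min_eq_left hx.le] at hn
      refine ⟨hx, g.lu hn hx, ?_⟩
      exact g.DA hn le_rfl hx.le g.l2 le_rfl hx (by rw [h_right g.e]) (g.lt_end hx)
    · left; exact c.xinj hx
    · right; right
      rw [min_eq_right hx.le] at hn
      refine ⟨hx, ?_, ?_⟩
      · rw [← lu_my]; exact g.tomy.lu hn.tomy hx
      · have := g.tomy.lt_end hx
        rw [h_my, y_my, x_my] at this
        exact g.DB hn hx.le le_rfl g.l2' le_rfl hx (by simpa using this) (by rw [h_right g.e'])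
  · left
    set S : Set V := {w | x0 < c.x w ∧ c.x w < min (c.x q) (c.x q') ∧
      c.h p q (c.x w) < c.y w ∧ c.y w < c.h p' q' (c.x w)} with hS
    have hne : S.Nonempty := by
      simp only [NoV] at hn
      push Not at hn
      obtain ⟨w, h1, h2, h3, h4⟩ := hn
      exact ⟨w, h1, h2, h3, h4⟩
    obtain ⟨w, hw, hmin⟩ := Set.exists_min_image S c.x (Set.toFinite _) hne
    obtain ⟨w1, w2, w3, w4⟩ := hw
    have wq := w2.trans_le (min_le_left _ _)
    have wq' := w2.trans_le (min_le_right _ _)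
    have n : c.NoV p q p' q' x0 (c.x w) := by
      intro v h1 h2 h3
      have := hmin v ⟨h1, h2.trans w2, h3⟩
      linarith
    refine ⟨w, w1, wq, wq', fun u e => ?_, ?_, ?_⟩
    · refine g.noedge n wq.le wq'.le e w1 le_rfl e.lt le_rfl ?_
      rw [h_right e]; exact ⟨w3, w4⟩
    · exact g.DA n wq.le wq'.le w1 le_rfl wq' w3.le w4
    · exact g.DB n wq.le wq'.le w1 le_rfl wq w3 w4.le

lemma nxtR.gap {s b a : V} (k : c.nxtR s b a) : c.Gap s b s a (c.x s) where
  e := k.1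
  e' := k.2.1
  l1 := le_rfl
  l1' := le_rfl
  l2 := k.1.lt
  l2' := k.2.1.lt
  lt := fun t h1 _ _ => slope_right k.1 k.2.1 k.2.2.1 h1
  blk := fun u v e hu t h1 h2 h3 h4 ⟨k1, k2⟩ => by
    have eb := k.1; have ea := k.2.1
    have := eb.lt; have := ea.lt
    rcases lt_or_eq_of_le hu with hu | hu
    · have m1 := order_keep eb e (t1 := t) (t2 := c.x s) (by linarith) (by linarith) (by linarith)
        (by linarith) le_rfl (by linarith) (by linarith) (by linarith) k1
      have m2 := order_keep e ea (t1 := t) (t2 := c.x s) (by linarith) (by linarith) (by linarith)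
        (by linarith) (by linarith) (by linarith) (by linarith) (by linarith) k2
      rw [h_left] at m1 m2
      exact vtx_ne e hu (by linarith) (le_antisymm m1 m2)
    · obtain rfl := c.xinj hu
      refine k.2.2.2 v e ⟨?_, ?_⟩
      · by_contra hh
        push Not at hh
        rcases lt_or_eq_of_le hh with hh | hh
        · have := slope_right e eb hh h1; linarith
        · obtain rfl := right_inj e eb hh
          exact lt_irrefl _ k1
      · by_contra hh
        push Not at hh
        rcases lt_or_eq_of_le hh with hh | hh
        · have := slope_right ea e hh h1; linarith
        · obtain rfl := right_inj e ea hh.symm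
          exact lt_irrefl _ k2

lemma DA.gap {s b a r : V} (k : c.DA (c.x b) (c.y b) s a) (kr : c.ru b r) :
    c.Gap b r s a (c.x b) where
  e := kr.1
  e' := k.1
  l1 := le_rfl
  l1' := k.2.1.le
  l2 := kr.1.lt
  l2' := k.2.2.1
  lt := fun t h1 h2 h3 => by
    obtain ⟨e, k1, k2, k3, -⟩ := k
    have := kr.1.lt
    refine order_keep_lt kr.1 e (t1 := c.x b) le_rfl (by linarith) (by linarith) (by linarith)
      (by linarith) (by linarith) (by linarith) (by linarith) (Or.inl ⟨h1, h2⟩) ?_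
    rwa [h_left]
  blk := fun u v e hu t h1 h2 h3 h4 ⟨m1, m2⟩ => by
    obtain ⟨ea, k1, k2, k3, k4⟩ := k
    have := kr.1.lt; have := ea.lt
    rcases lt_or_eq_of_le hu with hu | hu
    · have i1 := order_keep kr.1 e (t1 := t) (t2 := c.x b) (by linarith) (by linarith) (by linarith)
        (by linarith) (by linarith) (by linarith) (by linarith) (by linarith) m1
      have i2 := order_keep_lt e ea (t1 := t) (t2 := c.x b) (by linarith) (by linarith) (by linarith)
        (by linarith) (by linarith) (by linarith) (by linarith) (by linarith)
        (Or.inr ⟨by linarith, by linarith⟩) m2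
      rw [h_left] at i1
      have i3 := lt_of_le_of_ne i1 (vtx_ne e hu (by linarith))
      have := k4 u v e hu (by linarith) i3
      linarith
    · obtain rfl := c.xinj hu
      have hv := kr.2 v e
      rcases lt_or_eq_of_le hv with hv | hv
      · have := slope_right e kr.1 hv h1; linarith
      · obtain rfl := right_inj e kr.1 hv
        exact lt_irrefl _ m1

end Cfg

namespace Cfg
variable {V : Type*} {c : Cfg V}

lemma rhomb {s1 s2 u v a1 a2 b1 b2 : ℝ}
    (e1 : (u - s1) ^ 2 + (v - s2) ^ 2 = 1) (e2 : (a1 - s1) ^ 2 + (a2 - s2) ^ 2 = 1)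
    (e3 : (u - b1) ^ 2 + (v - b2) ^ 2 = 1) (e4 : (a1 - b1) ^ 2 + (a2 - b2) ^ 2 = 1)
    (n1 : u ≠ a1) (n2 : s1 ≠ b1) : u + a1 = s1 + b1 ∧ v + a2 = s2 + b2 := by
  set P1 := 2 * u - (s1 + b1) with hP1
  set P2 := 2 * v - (s2 + b2) with hP2
  set Q1 := 2 * a1 - (s1 + b1) with hQ1
  set Q2 := 2 * a2 - (s2 + b2) with hQ2
  have o1 : P1 * (s1 - b1) + P2 * (s2 - b2) = 0 := by rw [hP1, hP2]; linarith
  have o2 : Q1 * (s1 - b1) + Q2 * (s2 - b2) = 0 := by rw [hQ1, hQ2]; linarith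
  have nn : P1 ^ 2 + P2 ^ 2 = Q1 ^ 2 + Q2 ^ 2 := by
    rw [hP1, hP2, hQ1, hQ2]; linear_combination 2 * e1 - 2 * e2 + 2 * e3 - 2 * e4
  have cr : (s1 - b1) * ((P1 - Q1) * (P2 + Q2) - (P2 - Q2) * (P1 + Q1)) = 0 := by
    linear_combination (2 * Q2) * o1 - 2 * P2 * o2
  have cr' := (mul_eq_zero.1 cr).resolve_left (sub_ne_zero.2 n2)
  have sq : ((P1 - Q1) ^ 2 + (P2 - Q2) ^ 2) * ((P1 + Q1) ^ 2 + (P2 + Q2) ^ 2) = 0 := by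
    have : (P1 - Q1) * (P1 + Q1) + (P2 - Q2) * (P2 + Q2) = 0 := by linear_combination nn
    linear_combination ((P1 - Q1) * (P2 + Q2) - (P2 - Q2) * (P1 + Q1)) * cr' +
      ((P1 - Q1) * (P1 + Q1) + (P2 - Q2) * (P2 + Q2)) * this
  have ne : (P1 - Q1) ^ 2 + (P2 - Q2) ^ 2 ≠ 0 := by
    have : P1 - Q1 ≠ 0 := by
      rw [hP1, hQ1]; intro h; apply n1; linarith
    have : 0 < (P1 - Q1) ^ 2 := by positivity
    have h3 := sq_nonneg (P2 - Q2)
    intro h4; linarith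
  have z := (mul_eq_zero.1 sq).resolve_left ne
  have w1 := sq_nonneg (P1 + Q1)
  have w2 := sq_nonneg (P2 + Q2)
  have z1 : P1 + Q1 = 0 := pow_eq_zero_iff two_ne_zero |>.1 (le_antisymm (by linarith) w1)
  have z2 : P2 + Q2 = 0 := pow_eq_zero_iff two_ne_zero |>.1 (le_antisymm (by linarith) w2)
  constructor
  · rw [hP1, hQ1] at z1; linarith
  · rw [hP2, hQ2] at z2; linarith

/-- four-cycles of unit edges are parallelograms -/
lemma para {s u a b : V} (e1 : c.G.Adj s u) (e2 : c.G.Adj s a) (e3 : c.G.Adj b u)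
    (e4 : c.G.Adj b a) (n1 : u ≠ a) (n2 : s ≠ b) :
    c.x u + c.x a = c.x s + c.x b ∧ c.y u + c.y a = c.y s + c.y b :=
  rhomb (c.unit _ _ e1) (c.unit _ _ e2) (c.unit _ _ e3) (c.unit _ _ e4)
    (fun h => n1 (c.xinj h)) (fun h => n2 (c.xinj h))

lemma lu_unique {a a' b : V} (h1 : c.lu a b) (h2 : c.lu a' b) : a = a' :=
  left_inj h1.1 h2.1 (le_antisymm (h2.2 _ h1.1) (h1.2 _ h2.1))
lemma ru_unique {a b b' : V} (h1 : c.ru a b) (h2 : c.ru a b') : b = b' :=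
  right_inj h1.1 h2.1 (le_antisymm (h2.2 _ h1.1) (h1.2 _ h2.1))
lemma ld_unique {a a' b : V} (h1 : c.ld a b) (h2 : c.ld a' b) : a = a' :=
  left_inj h1.1 h2.1 (le_antisymm (h1.2 _ h2.1) (h2.2 _ h1.1))
lemma nxtR_unique {s b a a' : V} (h1 : c.nxtR s b a) (h2 : c.nxtR s b a') : a = a' := by
  rcases lt_trichotomy (c.y a) (c.y a') with h | h | h
  · exact absurd ⟨h1.2.2.1, h⟩ (h2.2.2.2 a h1.2.1)
  · exact right_inj h1.2.1 h2.2.1 h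
  · exact absurd ⟨h2.2.2.1, h⟩ (h1.2.2.2 a' h2.2.1)
lemma nxtR_unique' {s b b' a : V} (h1 : c.nxtR s b a) (h2 : c.nxtR s b' a) : b = b' :=
  nxtR_unique (c := c.my) (nxtR_my.2 h1) (nxtR_my.2 h2)
lemma exists_ru [Finite V] {b r : V} (e : c.E b r) : ∃ r, c.ru b r := by
  obtain ⟨m, h1, h2⟩ := Set.exists_max_image {v | c.E b v} c.y (Set.toFinite _) ⟨r, e⟩
  exact ⟨m, h1, h2⟩
lemma exists_nxtR [Finite V] {s b r : V} (e : c.E s b) (e' : c.E s r) (hy : c.y b < c.y r) :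
    ∃ a, c.nxtR s b a := by
  obtain ⟨m, h1, h2⟩ := Set.exists_min_image {v | c.E s v ∧ c.y b < c.y v} c.y (Set.toFinite _)
    ⟨r, e', hy⟩
  refine ⟨m, e, h1.1, h1.2, fun d ed hd => ?_⟩
  have := h2 d ⟨ed, hd.1⟩
  linarith [hd.2]

/-- a start of a face whose lower edge ends first -/
def FU3 (c : Cfg V) (s b a : V) : Prop :=
  c.nxtR s b a ∧ c.x b < c.x a ∧ c.NoV s b s a (c.x s) (c.x b)
def FU (c : Cfg V) (b : V) : Prop := ∃ s a, c.FU3 s b a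
def SP (c : Cfg V) (w : V) : Prop :=
  (∀ u, ¬ c.E u w) ∧ ∃ s b a, c.nxtR s b a ∧ c.DA (c.x w) (c.y w) s a ∧ c.DB (c.x w) (c.y w) s b
def ZR (c : Cfg V) (v : V) : Prop := ∀ u, ¬ c.E v u
def ZL (c : Cfg V) (v : V) : Prop := ∀ u, ¬ c.E u v
/-- a regular vertex with no token above -/
def U1 (c : Cfg V) (v : V) : Prop := ¬ c.ZR v ∧ ¬ c.ZL v ∧ ¬ c.FU v ∧ ¬ c.mx.FU v
/-- an (almost) closed region with upper edge `s a` and lower path `s b r` -/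
def Cap (c : Cfg V) (s b a r : V) : Prop :=
  c.FU3 s b a ∧ c.ru b r ∧ c.x a ≤ c.x r ∧ c.NoV b r s a (c.x b) (c.x a)
def Tri (c : Cfg V) (b : V) : Prop := ∃ s a, c.Cap s b a a
def RhW (c : Cfg V) (b a : V) : Prop :=
  ∃ s r, c.lu s b ∧ c.ru b r ∧ c.ld s a ∧ c.rd a r ∧ c.nxtR s b a ∧ c.nxtL r b a
def Rh1 (c : Cfg V) (b a : V) : Prop :=
  ∃ s r, c.Cap s b a r ∧ c.ld s a ∧ c.rd a r ∧ c.nxtL r b a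

lemma FU3.lu {s b a : V} (f : c.FU3 s b a) : c.lu s b := f.1.gap.lu f.2.2 f.2.1
lemma FU3.DA {s b a : V} (f : c.FU3 s b a) : c.DA (c.x b) (c.y b) s a :=
  f.1.gap.DA f.2.2 le_rfl f.2.1.le f.1.1.lt le_rfl f.2.1 (by rw [h_right f.1.1])
    (f.1.gap.lt_end f.2.1)
lemma FU3.unique {s b a s' a' : V} (f : c.FU3 s b a) (f' : c.FU3 s' b a') : s = s' ∧ a = a' :=
  DA_unique f.DA f'.DA
lemma FU.nZL {b : V} (f : c.FU b) : ¬ c.ZL b := by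
  obtain ⟨s, a, f⟩ := f
  exact fun h => h s f.1.1
lemma ZL_mx {v : V} : c.mx.ZL v ↔ c.ZR v := by simp only [ZL, ZR, E_mx]
lemma ZR_mx {v : V} : c.mx.ZR v ↔ c.ZL v := by simp only [ZL, ZR, E_mx]
lemma ZL_my {v : V} : c.my.ZL v ↔ c.ZL v := Iff.rfl
lemma ZR_my {v : V} : c.my.ZR v ↔ c.ZR v := Iff.rfl

lemma mymx : c.my.mx = c.mx.my := rfl
lemma my_my : c.my.my = c := by simp [my]
lemma mx_mx : c.mx.mx = c := by simp [mx]

lemma start_cases [Finite V] {s b a : V} (k : c.nxtR s b a) :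
    (∃ w, c.ZL w ∧ c.DA (c.x w) (c.y w) s a ∧ c.DB (c.x w) (c.y w) s b) ∨
    c.FU3 s b a ∨ c.my.FU3 s a b := by
  rcases gap_cases k.gap with ⟨w, -, -, -, h1, h2, h3⟩ | ⟨hn, rfl | ⟨h1, -, -⟩ | ⟨h1, -, -⟩⟩
  · exact Or.inl ⟨w, h1, h2, h3⟩
  · exact absurd k.2.2.1 (lt_irrefl _)
  · rw [min_eq_left h1.le] at hn
    exact Or.inr (Or.inl ⟨k, h1, hn⟩)
  · rw [min_eq_right h1.le] at hn
    exact Or.inr (Or.inr ⟨nxtR_my.2 k, h1, hn.tomy⟩)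

lemma NoV_mx {p q p' q' : V} {x0 xe : ℝ} (e : c.E q p) (e' : c.E q' p')
    (n : c.mx.NoV p q p' q' x0 xe) : c.NoV q p q' p' (-xe) (-x0) := by
  intro w h1 h2 h3
  refine n w (by rw [x_mx]; linarith) (by rw [x_mx]; linarith) ?_
  rw [h_mx e, h_mx e', x_mx, neg_neg, y_mx]
  exact h3

lemma tri_of {v : V} (h1 : c.FU v) (h2 : c.mx.FU v) : c.Tri v := by
  obtain ⟨s, a, f⟩ := h1
  obtain ⟨s', a', f'⟩ := h2
  have d' := f'.DA
  rw [DA_mx, x_mx, neg_neg, y_mx] at d'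
  obtain ⟨rfl, rfl⟩ := DA_unique f.DA d'
  refine ⟨s, a, f, lu_mx.1 f'.lu, le_rfl, ?_⟩
  have := NoV_mx (E_mx.1 f'.1.1) (E_mx.1 f'.1.2.1) f'.2.2
  simpa [x_mx] using this

lemma merge {v : V} (h1 : c.FU v) (h2 : c.my.FU v) (h3 : c.mx.SP v) : False := by
  obtain ⟨s1, a1, f1⟩ := h1
  obtain ⟨s2, a2, f2⟩ := h2
  obtain ⟨-, s, b, a, k, ka, kb⟩ := h3
  have d2 := f2.DA
  rw [DA_my, x_my, y_my, neg_neg] at d2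
  rw [DA_mx, x_mx, y_mx, neg_neg] at ka
  rw [DB_mx, x_mx, y_mx, neg_neg] at kb
  obtain ⟨rfl, rfl⟩ := DA_unique f1.DA ka
  obtain ⟨rfl, rfl⟩ := DB_unique d2 kb
  have e1 := f1.1.1
  have e2 : c.E s2 v := f2.1.1
  have e3 := f1.1.2.1
  have e4 : c.E s2 a2 := f2.1.2.1
  have hx := f1.2.1
  have hy := k.2.2.1
  have := para e1.1 e3.1 e2.1 e4.1 (by rintro rfl; exact lt_irrefl _ hx)
    (by rintro rfl; exact lt_irrefl _ hy)
  have l1 := e1.lt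
  have l4 := e4.lt
  linarith [this.1]

/-- classification of the face starts whose lower edge ends first -/
lemma F_cases [Finite V] {b : V} (f : c.FU b) :
    c.ZR b ∨ c.Tri b ∨ (∃ w, c.ZL w ∧ ∃ r, c.DB (c.x w) (c.y w) b r) ∨
    (∃ a, c.ZR a ∧ ∃ r, c.DB (c.x a) (c.y a) b r) ∨
    (∃ a, c.my.U1 a ∧ ∃ r, c.DB (c.x a) (c.y a) b r) ∨
    (∃ a, c.Rh1 b a) ∨ (∃ r, c.ZR r ∧ c.lu b r) ∨ (∃ r, c.U1 r ∧ c.lu b r) := by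
  obtain ⟨s, a, f⟩ := f
  by_cases hz : c.ZR b
  · exact Or.inl hz
  right
  simp only [ZR] at hz
  push Not at hz
  obtain ⟨r', er⟩ := hz
  obtain ⟨r, hr⟩ := exists_ru er
  have g := f.DA.gap hr
  rcases gap_cases g with ⟨w, -, -, -, h1, h2, h3⟩ | ⟨hn, rfl | ⟨h1, h2, h3⟩ | ⟨h1, h2, h3⟩⟩
  · exact Or.inr (Or.inl ⟨w, h1, r, h3⟩)
  · left
    exact ⟨s, r, f, hr, le_rfl, by simpa using hn⟩
  · -- the lower path ends first
    iterate 5 right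
    by_cases hz : c.ZR r
    · exact Or.inl ⟨r, hz, h2⟩
    refine Or.inr ⟨r, ⟨hz, fun h => h b hr.1, ?_, ?_⟩, h2⟩
    · rintro ⟨s', a', f'⟩
      obtain rfl := lu_unique f'.lu h2
      have := hr.2 a' f'.1.2.1
      linarith [f'.1.2.2.1]
    · rintro ⟨s', a', f'⟩
      have d' := f'.DA
      rw [DA_mx, x_mx, neg_neg, y_mx] at d'
      obtain ⟨rfl, rfl⟩ := DA_unique h3 d'
      have e1 : c.E r a := E_mx.1 f'.1.1
      have e2 := f.1.1
      have e3 := f.1.2.1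
      have := para e2.1 e3.1 hr.1.1.symm e1.1 (by rintro rfl; exact lt_irrefl _ f.2.1)
        (by rintro rfl; exact lt_irrefl _ (e2.lt.trans hr.1.lt))
      linarith [this.1, e2.lt]
  · -- the upper edge ends first
    right; right
    by_cases hz : c.ZR a
    · exact Or.inl ⟨a, hz, r, h3⟩
    right
    by_cases hF : c.my.mx.FU a
    · right; left
      obtain ⟨s', a', f'⟩ := hF
      have d' := f'.DA
      rw [DA_mx, DA_my, x_mx, neg_neg, x_my, y_mx, y_my, neg_neg] at d'
      obtain ⟨rfl, rfl⟩ := DB_unique h3 d'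
      rw [min_eq_right h1.le] at hn
      refine ⟨a, s, r, ⟨f, hr, h1.le, hn⟩, h2, ?_, ?_⟩
      · exact ru_my.1 (lu_mx.1 f'.lu)
      · exact nxtL_my.1 (nxtR_mx.1 f'.1)
    · left
      refine ⟨a, ⟨hz, fun h => h s f.1.2.1, ?_, hF⟩, r, h3⟩
      rintro ⟨s', a', f'⟩
      have d' := f'.DA
      rw [DA_my, x_my, y_my, neg_neg] at d'
      obtain ⟨rfl, rfl⟩ := DB_unique h3 d'
      obtain rfl := ld_unique h2 (lu_my.1 f'.lu)
      exact lt_irrefl _ f.1.1.lt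

lemma Rh1.W {b a : V} (h : c.Rh1 b a) : c.RhW b a := by
  obtain ⟨s, r, h1, h2, h3, h4⟩ := h
  exact ⟨s, r, h1.1.lu, h1.2.1, h2, h3, h1.1.1, h4⟩
lemma RhW_my {b a : V} : c.my.RhW b a ↔ c.RhW a b := by
  simp only [RhW, lu_my, ru_my, ld_my, rd_my, nxtR_my, nxtL_my]
  constructor
  · rintro ⟨s, r, h1, h2, h3, h4, h5, h6⟩; exact ⟨s, r, h3, h4, h1, h2, h5, h6⟩
  · rintro ⟨s, r, h1, h2, h3, h4, h5, h6⟩; exact ⟨s, r, h3, h4, h1, h2, h5, h6⟩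
lemma RhW.unique {b a a' : V} (h1 : c.RhW b a) (h2 : c.RhW b a') : a = a' := by
  obtain ⟨s, r, h1, -, -, -, h5, -⟩ := h1
  obtain ⟨s', r', h1', -, -, -, h5', -⟩ := h2
  obtain rfl := lu_unique h1 h1'
  exact nxtR_unique h5 h5'
lemma RhW.unique' {b b' a : V} (h1 : c.RhW b a) (h2 : c.RhW b' a) : b = b' :=
  RhW.unique (c := c.my) (RhW_my.2 h1) (RhW_my.2 h2)

end Cfg

/-- number of elements with a property -/
noncomputable def cnt {α : Type*} (P : α → Prop) : ℕ := Set.ncard {a | P a}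

lemma cnt_rel {α β : Type*} [Finite α] [Finite β] {P : α → Prop} {Q : β → Prop} (R : α → β → Prop)
    (h1 : ∀ a, P a → ∃ b, Q b ∧ R a b)
    (h2 : ∀ a a' b, P a → P a' → R a b → R a' b → a = a') : cnt P ≤ cnt Q := by
  classical
  by_cases hp : ∃ a, P a
  · obtain ⟨a0, ha0⟩ := hp
    obtain ⟨b0, -⟩ := h1 a0 ha0
    haveI : Nonempty β := ⟨b0⟩
    choose! f hf using h1
    refine Set.ncard_le_ncard_of_injOn f (fun a ha => (hf a ha).1) ?_ (Set.toFinite _)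
    intro a ha a' ha' hh
    exact h2 a a' (f a) ha ha' (hf a ha).2 (hh ▸ (hf a' ha').2)
  · push Not at hp
    simp [cnt, hp]

lemma cnt_mono {α : Type*} [Finite α] {P Q : α → Prop} (h : ∀ a, P a → Q a) : cnt P ≤ cnt Q :=
  Set.ncard_le_ncard h (Set.toFinite _)

lemma cnt_or {α : Type*} (P Q : α → Prop) :
    cnt (fun a => P a ∨ Q a) ≤ cnt P + cnt Q := Set.ncard_union_le _ _

lemma cnt_le_or {α : Type*} [Finite α] {P Q R : α → Prop} (h : ∀ a, P a → Q a ∨ R a) :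
    cnt P ≤ cnt Q + cnt R := (cnt_mono h).trans (cnt_or _ _)

open Classical in
lemma cnt_eq_sum {α : Type*} [Fintype α] (P : α → Prop) : cnt P = ∑ a, if P a then 1 else 0 := by
  rw [cnt, Set.ncard_eq_toFinset_card', Finset.sum_boole]
  simp

namespace Cfg
variable {V : Type*} {c : Cfg V}

lemma FU_count [Finite V] (c : Cfg V) : cnt c.FU ≤ cnt c.ZR + (cnt c.Tri + (cnt c.ZL + (cnt c.ZR +
    (cnt c.my.U1 + (cnt (fun b => ∃ a, c.Rh1 b a) + (cnt c.ZR + cnt c.U1)))))) := by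
  refine (cnt_mono (fun b hb => F_cases hb)).trans ?_
  refine (cnt_or _ _).trans (Nat.add_le_add le_rfl ?_)
  refine (cnt_or _ _).trans (Nat.add_le_add le_rfl ?_)
  refine (cnt_or _ _).trans (Nat.add_le_add ?_ ?_)
  · exact cnt_rel (fun b w => ∃ r, c.DB (c.x w) (c.y w) b r) (fun a h => h)
      fun a a' b _ _ ⟨r, h1⟩ ⟨r', h2⟩ => (DB_unique h1 h2).1
  refine (cnt_or _ _).trans (Nat.add_le_add ?_ ?_)
  · exact cnt_rel (fun b w => ∃ r, c.DB (c.x w) (c.y w) b r) (fun a h => h)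
      fun a a' b _ _ ⟨r, h1⟩ ⟨r', h2⟩ => (DB_unique h1 h2).1
  refine (cnt_or _ _).trans (Nat.add_le_add ?_ ?_)
  · exact cnt_rel (fun b w => ∃ r, c.DB (c.x w) (c.y w) b r) (fun a h => h)
      fun a a' b _ _ ⟨r, h1⟩ ⟨r', h2⟩ => (DB_unique h1 h2).1
  refine (cnt_or _ _).trans (Nat.add_le_add le_rfl ?_)
  refine (cnt_or _ _).trans (Nat.add_le_add ?_ ?_)
  · exact cnt_rel (fun b w => c.lu b w) (fun a h => h)
      fun a a' b _ _ h1 h2 => lu_unique h1 h2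
  · exact cnt_rel (fun b w => c.lu b w) (fun a h => h)
      fun a a' b _ _ h1 h2 => lu_unique h1 h2

/-- all edges, oriented to the right -/
def EP (c : Cfg V) (p : V × V) : Prop := c.E p.1 p.2

lemma EE_start [Fintype V] (c : Cfg V) :
    cnt c.EP + cnt c.ZR ≤ cnt (fun p : V × V => ∃ a, c.nxtR p.1 p.2 a) + Fintype.card V := by
  have h1 : cnt c.EP ≤ cnt (fun p : V × V => ∃ a, c.nxtR p.1 p.2 a) +
      cnt (fun p : V × V => c.ru p.1 p.2) := by
    apply cnt_le_or
    rintro ⟨s, b⟩ e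
    by_cases h : c.ru s b
    · exact Or.inr h
    · left
      simp only [ru, not_and, not_forall] at h
      obtain ⟨d, hd, hh⟩ := h e
      exact exists_nxtR e hd (by linarith)
  have h2 : cnt (fun p : V × V => c.ru p.1 p.2) ≤ cnt (fun s => ¬ c.ZR s) := by
    refine cnt_rel (fun p s => p.1 = s) ?_ ?_
    · rintro ⟨s, b⟩ h
      exact ⟨s, fun k => k b h.1, rfl⟩
    · rintro ⟨s, b⟩ ⟨s', b'⟩ t h h' rfl h3
      simp only at h3 h h'
      subst h3
      rw [ru_unique h h']
  have h3 : cnt (fun s => ¬ c.ZR s) + cnt c.ZR = Fintype.card V := by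
    classical
    rw [cnt_eq_sum, cnt_eq_sum, ← Finset.sum_add_distrib]
    rw [Finset.sum_congr rfl (g := fun _ => 1)]
    · simp
    · intro a _; by_cases h : c.ZR a <;> simp [h]
  omega

lemma start_count [Finite V] (c : Cfg V) : cnt (fun p : V × V => ∃ a, c.nxtR p.1 p.2 a) ≤
    cnt c.FU + (cnt c.my.FU + cnt c.SP) := by
  refine (cnt_mono (Q := fun p : V × V => (∃ a, c.FU3 p.1 p.2 a) ∨ (∃ a, c.my.FU3 p.1 a p.2) ∨
    (∃ a w, c.nxtR p.1 p.2 a ∧ c.ZL w ∧ c.DA (c.x w) (c.y w) p.1 a ∧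
      c.DB (c.x w) (c.y w) p.1 p.2)) ?_).trans ?_
  · rintro ⟨s, b⟩ ⟨a, h⟩
    rcases start_cases h with ⟨w, h1, h2, h3⟩ | h1 | h1
    · exact Or.inr (Or.inr ⟨a, w, h, h1, h2, h3⟩)
    · exact Or.inl ⟨a, h1⟩
    · exact Or.inr (Or.inl ⟨a, h1⟩)
  refine (cnt_or _ _).trans (Nat.add_le_add ?_ ((cnt_or _ _).trans (Nat.add_le_add ?_ ?_)))
  · refine cnt_rel (fun p b => ∃ a, p.2 = b ∧ c.FU3 p.1 b a) ?_ ?_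
    · rintro ⟨s, b⟩ ⟨a, h⟩; exact ⟨b, ⟨s, a, h⟩, a, rfl, h⟩
    · rintro ⟨s, b⟩ ⟨s', b'⟩ v - - ⟨a, rfl, h⟩ ⟨a', rfl, h'⟩
      simp only at h h'
      rw [(h.unique h').1]
  · refine cnt_rel (fun p a => c.my.FU3 p.1 a p.2) ?_ ?_
    · rintro ⟨s, b⟩ ⟨a, h⟩; exact ⟨a, ⟨s, b, h⟩, h⟩
    · rintro ⟨s, b⟩ ⟨s', b'⟩ v - - h h'
      simp only at h h'
      rw [(h.unique h').1, (h.unique h').2]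
  · refine cnt_rel (fun p w => c.DB (c.x w) (c.y w) p.1 p.2) ?_ ?_
    · rintro ⟨s, b⟩ ⟨a, w, h1, h2, h3, h4⟩; exact ⟨w, ⟨h2, s, b, a, h1, h3, h4⟩, h4⟩
    · rintro ⟨s, b⟩ ⟨s', b'⟩ w - - h h'
      simp only at h h'
      rw [(DB_unique h h').1, (DB_unique h h').2]

lemma EP_mx [Finite V] (c : Cfg V) : cnt c.EP ≤ cnt c.mx.EP := by
  refine cnt_rel (fun p q => p.1 = q.2 ∧ p.2 = q.1) ?_ ?_
  · rintro ⟨s, b⟩ h; exact ⟨(b, s), E_mx.2 h, rfl, rfl⟩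
  · rintro ⟨s, b⟩ ⟨s', b'⟩ ⟨u, v⟩ - - ⟨h1, h2⟩ ⟨h3, h4⟩
    simp_all

lemma merge_mx {v : V} (h1 : c.mx.FU v) (h2 : c.my.mx.FU v) (h3 : c.SP v) : False :=
  merge (c := c.mx) h1 h2 (by rwa [mx_mx])

lemma token_sum [Fintype V] (c : Cfg V) :
    cnt c.FU + cnt c.my.FU + cnt c.mx.FU + cnt c.my.mx.FU + cnt c.SP + cnt c.mx.SP + cnt c.U1 +
      cnt c.my.U1 ≤ 2 * Fintype.card V + cnt c.Tri + cnt c.my.Tri := by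
  classical
  have hc : 2 * Fintype.card V = ∑ _v : V, 2 := by simp [mul_comm]
  rw [hc]
  simp only [cnt_eq_sum, ← Finset.sum_add_distrib]
  apply Finset.sum_le_sum
  intro v _
  have t1 : c.FU v → c.mx.FU v → c.Tri v := tri_of
  have t2 : c.my.FU v → c.my.mx.FU v → c.my.Tri v := tri_of
  have m1 : c.FU v → c.my.FU v → c.mx.SP v → False := merge
  have m2 : c.mx.FU v → c.my.mx.FU v → c.SP v → False := merge_mx
  have z1 : c.FU v → ¬ c.ZL v := FU.nZL
  have z2 : c.my.FU v → ¬ c.ZL v := FU.nZL (c := c.my)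
  have z3 : c.mx.FU v → ¬ c.ZR v := fun h => by
    have := FU.nZL (c := c.mx) h
    rwa [ZL_mx] at this
  have z4 : c.my.mx.FU v → ¬ c.ZR v := fun h => by
    have := FU.nZL (c := c.my.mx) h
    rwa [ZL_mx] at this
  have s1 : c.SP v → c.ZL v := fun h => h.1
  have s2 : c.mx.SP v → c.ZR v := fun h => ZL_mx.1 h.1
  have u1 : c.U1 v ↔ ¬ c.ZR v ∧ ¬ c.ZL v ∧ ¬ c.FU v ∧ ¬ c.mx.FU v := Iff.rfl
  have u2 : c.my.U1 v ↔ ¬ c.ZR v ∧ ¬ c.ZL v ∧ ¬ c.my.FU v ∧ ¬ c.my.mx.FU v := Iff.rfl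
  generalize c.FU v = a1 at *
  generalize c.mx.FU v = b1 at *
  generalize c.my.FU v = a2 at *
  generalize c.my.mx.FU v = b2 at *
  generalize c.SP v = g at *
  generalize c.mx.SP v = d at *
  generalize c.Tri v = tu at *
  generalize c.my.Tri v = td at *
  generalize c.ZL v = zl at *
  generalize c.ZR v = zr at *
  rw [if_congr u1 rfl rfl, if_congr u2 rfl rfl]
  by_cases hl : zl <;> by_cases hr : zr <;> by_cases h1 : a1 <;> by_cases h2 : a2 <;>
    by_cases h3 : b1 <;> by_cases h4 : b2 <;> simp_all <;> split_ifs <;> simp_all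

/-- the (cap) rhombi -/
def Rh (c : Cfg V) (b a : V) : Prop := c.Rh1 b a ∨ c.my.Rh1 a b

lemma Rh.W {b a : V} (h : c.Rh b a) : c.RhW b a := by
  rcases h with h | h
  · exact h.W
  · exact RhW_my.1 h.W

/-- number of triangle caps -/
noncomputable def tt (c : Cfg V) : ℕ := cnt c.Tri + cnt c.my.Tri
noncomputable def uu (c : Cfg V) : ℕ := cnt c.U1 + cnt c.my.U1

lemma D_bound [Fintype V] (c : Cfg V) :
    2 * cnt c.EP + cnt c.ZR + cnt c.ZL + c.uu ≤ 4 * Fintype.card V + c.tt := by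
  have h1 := EE_start c
  have h2 := EE_start c.mx
  have h3 := start_count c
  have h4 := start_count c.mx
  have h5 := EP_mx c
  have h6 := token_sum c
  have h7 : cnt c.mx.ZR = cnt c.ZL := by simp only [cnt, ZR_mx]
  rw [← mymx] at h4
  simp only [tt, uu]
  omega

lemma rho_bound [Fintype V] (c : Cfg V) :
    cnt c.EP ≤ Fintype.card V + cnt (fun b => ∃ a, c.Rh b a) + 6 * cnt c.ZR + 3 * cnt c.ZL +
      2 * c.uu + c.tt := by
  have h1 := EE_start c
  have h3 := start_count c
  have f1 := FU_count c
  have f2 := FU_count c.my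
  rw [my_my] at f2
  have h7 : cnt c.my.ZR = cnt c.ZR := rfl
  have h8 : cnt c.my.ZL = cnt c.ZL := rfl
  have h9 : cnt c.SP ≤ cnt c.ZL := cnt_mono fun v h => h.1
  have r2 : cnt (fun b => ∃ a, c.my.Rh1 b a) ≤ cnt (fun b => ∃ a, c.my.Rh1 a b) := by
    refine cnt_rel (fun b a => c.my.Rh1 b a) ?_ ?_
    · rintro a ⟨b, h⟩; exact ⟨b, ⟨a, h⟩, h⟩
    · rintro b b' a - - h h'
      exact h.W.unique' h'.W
  have r1 : cnt (fun b => ∃ a, c.Rh1 b a) + cnt (fun b => ∃ a, c.my.Rh1 a b) ≤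
      cnt (fun b => ∃ a, c.Rh b a) := by
    classical
    rw [cnt_eq_sum, cnt_eq_sum, cnt_eq_sum, ← Finset.sum_add_distrib]
    apply Finset.sum_le_sum
    intro b _
    have k1 : (∃ a, c.Rh1 b a) → (∃ a, c.Rh b a) := fun ⟨a, h⟩ => ⟨a, Or.inl h⟩
    have k2 : (∃ a, c.my.Rh1 a b) → (∃ a, c.Rh b a) := fun ⟨a, h⟩ => ⟨a, Or.inr h⟩
    have k3 : (∃ a, c.Rh1 b a) → (∃ a, c.my.Rh1 a b) → False := by
      rintro ⟨a, h⟩ ⟨a', h'⟩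
      obtain rfl := h.W.unique (RhW_my.1 h'.W)
      obtain ⟨s, r, h1, -⟩ := h
      obtain ⟨s', r', h1', -⟩ := h'
      have l1 := h1.1.2.1
      have l2 := h1'.1.2.1
      simp only [x_my] at l2
      linarith
    split_ifs <;> simp_all
  simp only [tt, uu]
  omega

end Cfg

open MeasureTheory

lemma disk_vol (ox oy r : ℝ) (hr : 0 ≤ r) :
    volume {v : Fin 2 → ℝ | (v 0 - ox) ^ 2 + (v 1 - oy) ^ 2 ≤ r ^ 2} = ENNReal.ofReal (Real.pi * r ^ 2) := by
  have h := PiLp.volume_preserving_toLp (Fin 2)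
  have h2 := h.measure_preimage (s := Metric.closedBall (!₂[ox, oy]) r)
    Metric.isClosed_closedBall.measurableSet.nullMeasurableSet
  rw [EuclideanSpace.volume_closedBall_fin_two] at h2
  convert h2 using 2
  · ext v
    simp only [Set.mem_ofPred_eq, Set.mem_preimage, Metric.mem_closedBall, EuclideanSpace.dist_eq]
    rw [Real.sqrt_le_left hr]
    simp [Real.dist_eq, sq_abs]
  · rw [mul_comm, ENNReal.ofReal_mul (by positivity), ENNReal.ofReal_pow hr]

lemma area_pack {ι : Type*} (S : Finset ι) (px py ux uy vx vy : ι → ℝ) {σ r ox oy : ℝ} (hσ : 0 < σ)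
    (hr : 0 ≤ r) (hdet : ∀ i ∈ S, σ ≤ ux i * vy i - uy i * vx i)
    (hin : ∀ i ∈ S, ∀ l m : ℝ, 0 < l → l < 1 / 2 → 0 < m → m < 1 / 2 →
      (px i + l * ux i + m * vx i - ox) ^ 2 + (py i + l * uy i + m * vy i - oy) ^ 2 ≤ r ^ 2)
    (hdis : ∀ i ∈ S, ∀ j ∈ S, ∀ l m l' m' : ℝ, 0 < l → l < 1 / 2 → 0 < m → m < 1 / 2 →
      0 < l' → l' < 1 / 2 → 0 < m' → m' < 1 / 2 →
      px i + l * ux i + m * vx i = px j + l' * ux j + m' * vx j →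
      py i + l * uy i + m * vy i = py j + l' * uy j + m' * vy j → i = j) :
    S.card * (σ / 4) ≤ Real.pi * r ^ 2 := by
  set Bx : Set (Fin 2 → ℝ) := Set.pi Set.univ fun _ => Set.Ioo (0 : ℝ) (1 / 2) with hBx
  set M : ι → Matrix (Fin 2) (Fin 2) ℝ := fun i => !![ux i, vx i; uy i, vy i] with hM
  set f : ι → (Fin 2 → ℝ) → (Fin 2 → ℝ) := fun i v => ![px i, py i] + Matrix.toLin' (M i) v with hf
  have f0 : ∀ i v, f i v 0 = px i + v 0 * ux i + v 1 * vx i := by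
    intro i v
    simp [hf, hM, Matrix.toLin'_apply, dotProduct, Fin.sum_univ_two]; ring
  have f1 : ∀ i v, f i v 1 = py i + v 0 * uy i + v 1 * vy i := by
    intro i v
    simp [hf, hM, Matrix.toLin'_apply, dotProduct, Fin.sum_univ_two]; ring
  have hB : ∀ v, v ∈ Bx ↔ (0 < v 0 ∧ v 0 < 1 / 2) ∧ (0 < v 1 ∧ v 1 < 1 / 2) := by
    intro v; simp [hBx, Set.mem_pi, Fin.forall_fin_two]
  have hdetM : ∀ i, (M i).det = ux i * vy i - uy i * vx i := by
    intro i; simp [hM, Matrix.det_fin_two]; ring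
  have vol : ∀ i ∈ S, ENNReal.ofReal (σ / 4) ≤ volume (f i '' Bx) := by
    intro i hi
    have e : f i '' Bx = (fun v => ![px i, py i] + v) '' (Matrix.toLin' (M i) '' Bx) := by
      rw [Set.image_image]
    rw [e, Set.image_add_left, measure_preimage_add, Measure.addHaar_image_linearMap,
      LinearMap.det_toLin', hBx, Real.volume_pi_Ioo]
    simp only [Fin.prod_univ_two, hdetM]
    rw [← ENNReal.ofReal_mul (by norm_num), ← ENNReal.ofReal_mul (by positivity)]
    apply ENNReal.ofReal_le_ofReal
    have := hdet i hi
    rw [abs_of_pos (by linarith)]; linarith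
  have inj : ∀ i ∈ S, Function.Injective (f i) := by
    intro i hi v w h
    have h0 := congrFun h 0
    have h1 := congrFun h 1
    rw [f0, f0] at h0
    rw [f1, f1] at h1
    have d : ux i * vy i - uy i * vx i ≠ 0 := by linarith [hdet i hi]
    have a0 : (ux i * vy i - uy i * vx i) * (v 0 - w 0) = 0 := by
      linear_combination vy i * h0 - vx i * h1
    have a1 : (ux i * vy i - uy i * vx i) * (v 1 - w 1) = 0 := by
      linear_combination ux i * h1 - uy i * h0
    have b0 := (mul_eq_zero.1 a0).resolve_left d
    have b1 := (mul_eq_zero.1 a1).resolve_left d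
    ext k; fin_cases k
    · simp; linarith
    · simp; linarith
  have hBm : MeasurableSet Bx := MeasurableSet.univ_pi fun _ => measurableSet_Ioo
  have cont : ∀ i, Continuous (f i) := by
    intro i
    apply continuous_const.add
    exact LinearMap.continuous_of_finiteDimensional _
  have meas : ∀ i ∈ S, MeasurableSet (f i '' Bx) := fun i hi =>
    hBm.image_of_continuousOn_injOn (cont i).continuousOn (inj i hi).injOn
  have dis : Set.PairwiseDisjoint (S : Set ι) fun i => f i '' Bx := by
    intro i hi j hj hij
    rw [Function.onFun, Set.disjoint_left]
    rintro z ⟨v, hv, rfl⟩ ⟨w, hw, hh⟩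
    apply hij
    rw [hB] at hv hw
    have h0 := congrFun hh 0
    have h1 := congrFun hh 1
    rw [f0, f0] at h0
    rw [f1, f1] at h1
    exact hdis i hi j hj _ _ _ _ hv.1.1 hv.1.2 hv.2.1 hv.2.2 hw.1.1 hw.1.2 hw.2.1 hw.2.2 h0.symm h1.symm
  have key : (S.card : ENNReal) * ENNReal.ofReal (σ / 4) ≤ ENNReal.ofReal (Real.pi * r ^ 2) := by
    calc (S.card : ENNReal) * ENNReal.ofReal (σ / 4) = ∑ i ∈ S, ENNReal.ofReal (σ / 4) := by simp
      _ ≤ ∑ i ∈ S, volume (f i '' Bx) := Finset.sum_le_sum vol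
      _ = volume (⋃ i ∈ S, f i '' Bx) := (measure_biUnion_finset dis meas).symm
      _ ≤ volume {v : Fin 2 → ℝ | (v 0 - ox) ^ 2 + (v 1 - oy) ^ 2 ≤ r ^ 2} := by
          apply measure_mono
          intro z hz
          simp only [Set.mem_iUnion] at hz
          obtain ⟨i, hi, v, hv, rfl⟩ := hz
          rw [hB] at hv
          have := hin i hi _ _ hv.1.1 hv.1.2 hv.2.1 hv.2.2
          rw [Set.mem_ofPred_eq, f0, f1]
          exact this
      _ = _ := disk_vol ox oy r hr
  rw [← ENNReal.ofReal_natCast, ← ENNReal.ofReal_mul (by positivity)] at key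
  exact (ENNReal.ofReal_le_ofReal_iff (by positivity)).1 key

namespace Cfg
variable {V : Type*} {c : Cfg V}

/-- cross product of `b - s` and `a - s` -/
def cr (c : Cfg V) (s b a : V) : ℝ :=
  (c.x b - c.x s) * (c.y a - c.y s) - (c.y b - c.y s) * (c.x a - c.x s)

/-- a cap which is a rhombus or a triangle -/
def Cap' (c : Cfg V) (s b a : V) : Prop :=
  ∃ r, c.Cap s b a r ∧ (r = a ∨ (c.x r = c.x b + c.x a - c.x s ∧ c.y r = c.y b + c.y a - c.y s))

lemma Cap'.cr_pos {s b a : V} (h : c.Cap' s b a) : 0 < c.cr s b a := by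
  obtain ⟨r, h, -⟩ := h
  have k := h.1.1
  have l1 := k.1.lt
  have l2 := k.2.1.lt
  have := slope_aux (by linarith) (by linarith) k.1.sq k.2.1.sq
    (show c.y b - c.y s < c.y a - c.y s by linarith [k.2.2.1])
  rw [cr]; linarith

lemma Cap'.cell {s b a : V} (h : c.Cap' s b a) {l m : ℝ} (l0 : 0 < l) (l1 : l < 1 / 2) (m0 : 0 < m)
    (m1 : m < 1 / 2) :
    c.DA (c.x s + l * (c.x b - c.x s) + m * (c.x a - c.x s))
      (c.y s + l * (c.y b - c.y s) + m * (c.y a - c.y s)) s a := by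
  have hc := h.cr_pos
  obtain ⟨r, ⟨f, hru, hx, hn⟩, hr⟩ := h
  have k := f.1
  have lb : 0 < c.x b - c.x s := by linarith [k.1.lt]
  have la : 0 < c.x a - c.x s := by linarith [k.2.1.lt]
  have lab : c.x b < c.x a := f.2.1
  rw [cr] at hc
  set zx := c.x s + l * (c.x b - c.x s) + m * (c.x a - c.x s) with hzx
  set zy := c.y s + l * (c.y b - c.y s) + m * (c.y a - c.y s) with hzy
  have z1 : c.x s < zx := by
    have := mul_pos l0 lb; have := mul_pos m0 la; linarith
  have z2 : zx < c.x a := by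
    have := mul_lt_mul_of_pos_right l1 lb
    have := mul_lt_mul_of_pos_right m1 la
    linarith
  have above : zy < c.h s a zx := by
    have : c.h s a zx - zy = l * ((c.x b - c.x s) * (c.y a - c.y s) - (c.y b - c.y s) * (c.x a - c.x s)) /
        (c.x a - c.x s) := by
      rw [Cfg.h, hzx, hzy]; field_simp; ring
    have h2 : 0 < c.h s a zx - zy := by rw [this]; positivity
    linarith
  rcases le_or_gt zx (c.x b) with hz | hz
  · refine k.gap.DA f.2.2 le_rfl lab.le z1 hz z2 ?_ above
    have : zy - c.h s b zx = m * ((c.x b - c.x s) * (c.y a - c.y s) - (c.y b - c.y s) * (c.x a - c.x s)) /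
        (c.x b - c.x s) := by
      rw [Cfg.h, hzx, hzy]; field_simp; ring
    have h2 : 0 < zy - c.h s b zx := by rw [this]; positivity
    linarith
  · refine (f.DA.gap hru).DA hn hx le_rfl hz z2.le z2 ?_ above
    rcases hr with rfl | ⟨r1, r2⟩
    · have lr : 0 < c.x r - c.x b := by linarith
      have : zy - c.h b r zx = (1 - l - m) *
        ((c.x b - c.x s) * (c.y r - c.y s) - (c.y b - c.y s) * (c.x r - c.x s)) / (c.x r - c.x b) := by
        rw [Cfg.h, hzx, hzy]; field_simp; ring
      have h3 : 0 < 1 - l - m := by linarith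
      have h2 : 0 < zy - c.h b r zx := by rw [this]; positivity
      linarith
    · have : zy - c.h b r zx = (1 - l) *
        ((c.x b - c.x s) * (c.y a - c.y s) - (c.y b - c.y s) * (c.x a - c.x s)) / (c.x a - c.x s) := by
        rw [Cfg.h, hzx, hzy, r1, r2, show c.x b + c.x a - c.x s - c.x b = c.x a - c.x s by ring,
          show c.y b + c.y a - c.y s - c.y b = c.y a - c.y s by ring]
        field_simp; ring
      have h3 : 0 < 1 - l := by linarith
      have h2 : 0 < zy - c.h b r zx := by rw [this]; positivity
      linarith

lemma convex_disk {x1 x2 x3 y1 y2 y3 ox oy r l m : ℝ} (l0 : 0 < l) (m0 : 0 < m) (lm : l + m < 1)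
    (h1 : (x1 - ox) ^ 2 + (y1 - oy) ^ 2 ≤ r ^ 2) (h2 : (x2 - ox) ^ 2 + (y2 - oy) ^ 2 ≤ r ^ 2)
    (h3 : (x3 - ox) ^ 2 + (y3 - oy) ^ 2 ≤ r ^ 2) :
    (x1 + l * (x2 - x1) + m * (x3 - x1) - ox) ^ 2 + (y1 + l * (y2 - y1) + m * (y3 - y1) - oy) ^ 2
      ≤ r ^ 2 := by
  have k : 0 < 1 - l - m := by linarith
  have e1 := mul_le_mul_of_nonneg_left h1 k.le
  have e2 := mul_le_mul_of_nonneg_left h2 l0.le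
  have e3 := mul_le_mul_of_nonneg_left h3 m0.le
  have d1 : 0 ≤ (1 - l - m) * l * ((x1 - x2) ^ 2 + (y1 - y2) ^ 2) := by positivity
  have d2 : 0 ≤ (1 - l - m) * m * ((x1 - x3) ^ 2 + (y1 - y3) ^ 2) := by positivity
  have d3 : 0 ≤ l * m * ((x2 - x3) ^ 2 + (y2 - y3) ^ 2) := by positivity
  have id : (1 - l - m) * ((x1 - ox) ^ 2 + (y1 - oy) ^ 2) + l * ((x2 - ox) ^ 2 + (y2 - oy) ^ 2) +
      m * ((x3 - ox) ^ 2 + (y3 - oy) ^ 2) =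
    (x1 + l * (x2 - x1) + m * (x3 - x1) - ox) ^ 2 + (y1 + l * (y2 - y1) + m * (y3 - y1) - oy) ^ 2 +
    (1 - l - m) * l * ((x1 - x2) ^ 2 + (y1 - y2) ^ 2) +
    (1 - l - m) * m * ((x1 - x3) ^ 2 + (y1 - y3) ^ 2) +
    l * m * ((x2 - x3) ^ 2 + (y2 - y3) ^ 2) := by ring
  linarith

/-- number of caps with cross product at least `σ` -/
lemma cap_count [Finite V] (c : Cfg V) {ox oy r σ : ℝ} (hr : 0 ≤ r) (hσ : 0 < σ)
    (hd : ∀ v, (c.x v - ox) ^ 2 + (c.y v - oy) ^ 2 ≤ r ^ 2) :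
    (cnt (fun b => ∃ s a, c.Cap' s b a ∧ σ ≤ c.cr s b a) : ℝ) * (σ / 4) ≤ Real.pi * r ^ 2 := by
  classical
  have h0 : cnt (fun b => ∃ s a, c.Cap' s b a ∧ σ ≤ c.cr s b a) ≤
      cnt (fun p : V × V × V => c.Cap' p.1 p.2.1 p.2.2 ∧ σ ≤ c.cr p.1 p.2.1 p.2.2) := by
    refine cnt_rel (fun b p => p.2.1 = b) ?_ ?_
    · rintro b ⟨s, a, h⟩; exact ⟨(s, b, a), h, rfl⟩
    · rintro b b' p - - h h'; exact h.symm.trans h'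
  set T := {p : V × V × V | c.Cap' p.1 p.2.1 p.2.2 ∧ σ ≤ c.cr p.1 p.2.1 p.2.2} with hT
  have hfin : T.Finite := Set.toFinite _
  have key := area_pack hfin.toFinset (fun p => c.x p.1) (fun p => c.y p.1)
    (fun p => c.x p.2.1 - c.x p.1) (fun p => c.y p.2.1 - c.y p.1)
    (fun p => c.x p.2.2 - c.x p.1) (fun p => c.y p.2.2 - c.y p.1) (ox := ox) (oy := oy) hσ hr ?_ ?_ ?_
  · rw [← Set.ncard_eq_toFinset_card T hfin] at key
    refine le_trans (mul_le_mul_of_nonneg_right ?_ (by positivity)) key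
    exact_mod_cast h0
  · intro p hp
    rw [Set.Finite.mem_toFinset] at hp
    exact hp.2
  · intro p hp l m l0 l1 m0 m1
    exact convex_disk l0 m0 (by linarith) (hd _) (hd _) (hd _)
  · intro p hp q hq l m l' m' l0 l1 m0 m1 l0' l1' m0' m1' e1 e2
    rw [Set.Finite.mem_toFinset] at hp hq
    have d1 := hp.1.cell l0 l1 m0 m1
    have d2 := hq.1.cell l0' l1' m0' m1'
    rw [e1, e2] at d1
    obtain ⟨h1, h2⟩ := DA_unique d1 d2
    obtain ⟨s, b, a⟩ := p
    obtain ⟨s', b', a'⟩ := q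
    simp only at h1 h2
    subst h1 h2
    obtain ⟨r1, k1, -⟩ := hp.1
    obtain ⟨r2, k2, -⟩ := hq.1
    obtain rfl := nxtR_unique' k1.1.1 k2.1.1
    rfl

end Cfg

namespace Cfg
variable {V : Type*} {c : Cfg V}

/-- thin rhombus: `b` bottom vertex, `a` top vertex -/
def RhT (c : Cfg V) (τ : ℝ) (b a : V) : Prop :=
  ∃ s r, c.lu s b ∧ c.ru b r ∧ c.ld s a ∧ c.rd a r ∧ c.nxtR s b a ∧ c.nxtL r b a ∧ c.cr s b a < τ

lemma RhT.W {τ : ℝ} {b a : V} (h : c.RhT τ b a) : c.RhW b a := by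
  obtain ⟨s, r, h1, h2, h3, h4, h5, h6, -⟩ := h
  exact ⟨s, r, h1, h2, h3, h4, h5, h6⟩

lemma sq_para {s r b a : V} (h1 : c.E s b) (h2 : c.E b r) (h3 : c.E s a) (h4 : c.E a r)
    (hn : b ≠ a) : c.x b + c.x a = c.x s + c.x r ∧ c.y b + c.y a = c.y s + c.y r :=
  para h1.1 h3.1 h2.1.symm h4.1.symm hn
    (by rintro rfl; exact lt_irrefl _ (h1.lt.trans h2.lt))

lemma ld_mx {a b : V} : c.mx.ld a b ↔ c.rd b a := by
  simp only [ld, rd, E_mx]; rfl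
lemma rd_mx {a b : V} : c.mx.rd a b ↔ c.ld b a := by
  simp only [ld, rd, E_mx]; rfl

lemma RhT.tomx {τ : ℝ} {b a : V} (h : c.RhT τ b a) : c.mx.RhT τ b a := by
  obtain ⟨s, r, h1, h2, h3, h4, h5, h6, h7⟩ := h
  refine ⟨r, s, lu_mx.2 h2, ru_mx.2 h1, ld_mx.2 h4, rd_mx.2 h3, nxtR_mx.2 h6, nxtL_mx.2 h5, ?_⟩
  have := sq_para h1.1 h2.1 h3.1 h4.1 (by rintro rfl; exact lt_irrefl _ h5.2.2.1)
  have e1 : c.x r = c.x b + c.x a - c.x s := by linarith [this.1]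
  have e2 : c.y r = c.y b + c.y a - c.y s := by linarith [this.2]
  have : c.mx.cr r b a = c.cr s b a := by
    simp only [cr, x_mx, y_mx, e1, e2]; ring
  rwa [this]

lemma RhT_mx {τ : ℝ} {b a : V} : c.mx.RhT τ b a ↔ c.RhT τ b a :=
  ⟨fun h => by simpa [mx_mx] using h.tomx, fun h => h.tomx⟩

def Good (c : Cfg V) (τ : ℝ) (b : V) : Prop := ∃ a, c.RhT τ b a
lemma Good_mx {τ : ℝ} {b : V} : c.mx.Good τ b ↔ c.Good τ b := by simp only [Good, RhT_mx]

/-- first edge of the lower path of a thin rhombus -/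
def ES (c : Cfg V) (τ : ℝ) (a b : V) : Prop := c.Good τ b ∧ c.lu a b
/-- second edge of the lower path of a thin rhombus -/
def EC (c : Cfg V) (τ : ℝ) (a b : V) : Prop := c.Good τ a ∧ c.ru a b
def Bad (c : Cfg V) (τ : ℝ) (a b : V) : Prop := c.E a b ∧ ¬ c.ES τ a b ∧ ¬ c.EC τ a b

lemma ES_mx {τ : ℝ} {a b : V} : c.mx.ES τ a b ↔ c.EC τ b a := by simp only [ES, EC, Good_mx, lu_mx]
lemma EC_mx {τ : ℝ} {a b : V} : c.mx.EC τ a b ↔ c.ES τ b a := by simp only [ES, EC, Good_mx, ru_mx]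
lemma Bad_mx {τ : ℝ} {a b : V} : c.mx.Bad τ a b ↔ c.Bad τ b a := by
  simp only [Bad, ES_mx, EC_mx, E_mx]; tauto

/-- fat rhombi -/
noncomputable def qq (c : Cfg V) (τ : ℝ) : ℕ := cnt (fun b => ∃ s a, c.Cap' s b a ∧ τ ≤ c.cr s b a) +
  cnt (fun b => ∃ s a, c.my.Cap' s b a ∧ τ ≤ c.my.cr s b a)

lemma Rh1.cap {b a : V} (h : c.Rh1 b a) : ∃ s, c.Cap' s b a ∧ ∃ r, c.lu s b ∧ c.ru b r ∧ c.ld s a ∧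
    c.rd a r ∧ c.nxtR s b a ∧ c.nxtL r b a := by
  obtain ⟨s, r, h1, h2, h3, h4⟩ := h
  refine ⟨s, ⟨r, h1, Or.inr ?_⟩, r, h1.1.lu, h1.2.1, h2, h3, h1.1.1, h4⟩
  have := sq_para h1.1.1.1 h1.2.1.1 h2.1 h3.1 (by rintro rfl; exact lt_irrefl _ h4.2.2.1)
  constructor
  · linarith [this.1]
  · linarith [this.2]

lemma fat_count [Finite V] (c : Cfg V) (τ : ℝ) :
    cnt (fun b => ∃ a, c.Rh b a) ≤ cnt (c.Good τ) + c.qq τ := by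
  have h0 : cnt (fun b => ∃ a s, c.my.Cap' s a b ∧ c.RhW b a ∧ τ ≤ c.my.cr s a b) ≤
      cnt (fun b => ∃ s a, c.my.Cap' s b a ∧ τ ≤ c.my.cr s b a) := by
    refine cnt_rel (fun b a => c.RhW b a) ?_ ?_
    · rintro b ⟨a, s, h1, h2, h3⟩; exact ⟨a, ⟨s, b, h1, h3⟩, h2⟩
    · rintro b b' a - - h h'; exact h.unique' h'
  refine le_trans (cnt_le_or (Q := c.Good τ) (R := fun b =>
    (∃ s a, c.Cap' s b a ∧ τ ≤ c.cr s b a) ∨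
    (∃ a s, c.my.Cap' s a b ∧ c.RhW b a ∧ τ ≤ c.my.cr s a b)) ?_)
    (Nat.add_le_add_left ((cnt_or _ _).trans (Nat.add_le_add_left h0 _)) _)
  rintro b ⟨a, h⟩
  rcases h with h | h
  · obtain ⟨s, h1, r, h2⟩ := h.cap
    by_cases hh : c.cr s b a < τ
    · exact Or.inl ⟨a, s, r, h2.1, h2.2.1, h2.2.2.1, h2.2.2.2.1, h2.2.2.2.2.1, h2.2.2.2.2.2, hh⟩
    · exact Or.inr (Or.inl ⟨s, a, h1, not_lt.1 hh⟩)
  · obtain ⟨s, h1, r, h2⟩ := h.cap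
    simp only [lu_my, ru_my, ld_my, rd_my, nxtR_my, nxtL_my] at h2
    have e : c.my.cr s a b = c.cr s b a := by simp only [cr, x_my, y_my]; ring
    by_cases hh : c.cr s b a < τ
    · exact Or.inl ⟨a, s, r, h2.2.2.1, h2.2.2.2.1, h2.1, h2.2.1, h2.2.2.2.2.1, h2.2.2.2.2.2, hh⟩
    · exact Or.inr (Or.inr ⟨a, s, h1, RhW_my.1 h.W, by rw [e]; exact not_lt.1 hh⟩)

lemma disk_my {ox oy r : ℝ} (hd : ∀ v, (c.x v - ox) ^ 2 + (c.y v - oy) ^ 2 ≤ r ^ 2) :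
    ∀ v, (c.my.x v - ox) ^ 2 + (c.my.y v - (-oy)) ^ 2 ≤ r ^ 2 := by
  intro v
  rw [x_my, y_my]
  have := hd v
  nlinarith

lemma qq_bound [Finite V] (c : Cfg V) {ox oy r σ : ℝ} (hr : 0 ≤ r) (hσ : 0 < σ)
    (hd : ∀ v, (c.x v - ox) ^ 2 + (c.y v - oy) ^ 2 ≤ r ^ 2) :
    (c.qq σ : ℝ) * σ ≤ 8 * Real.pi * r ^ 2 := by
  have h1 := cap_count c hr hσ hd
  have h2 := cap_count c.my hr hσ (disk_my hd)
  rw [qq]; push_cast; linarith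

lemma tri_cap {b : V} (h : c.Tri b) : ∃ s a, c.Cap' s b a ∧ 0.866 ≤ c.cr s b a := by
  obtain ⟨s, a, h⟩ := h
  have h' : c.Cap' s b a := ⟨a, h, Or.inl rfl⟩
  refine ⟨s, a, h', ?_⟩
  have e1 := h.1.1.1.sq
  have e2 := h.1.1.2.1.sq
  have e3 := h.2.1.1.sq
  have p := h'.cr_pos
  have : c.cr s b a ^ 2 = 3 / 4 := by
    have hdot : (c.x b - c.x s) * (c.x a - c.x s) + (c.y b - c.y s) * (c.y a - c.y s) = 1 / 2 := by
      linear_combination (1 / 2) * e1 + (1 / 2) * e2 - (1 / 2) * e3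
    have id : c.cr s b a ^ 2 + ((c.x b - c.x s) * (c.x a - c.x s) + (c.y b - c.y s) * (c.y a - c.y s)) ^ 2 =
      ((c.x b - c.x s) ^ 2 + (c.y b - c.y s) ^ 2) * ((c.x a - c.x s) ^ 2 + (c.y a - c.y s) ^ 2) := by
      rw [cr]; ring
    rw [hdot, e1, e2] at id
    linarith
  nlinarith

lemma tt_bound [Finite V] (c : Cfg V) {ox oy r : ℝ} (hr : 0 ≤ r)
    (hd : ∀ v, (c.x v - ox) ^ 2 + (c.y v - oy) ^ 2 ≤ r ^ 2) :
    (c.tt : ℝ) * 0.866 ≤ 8 * Real.pi * r ^ 2 := by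
  refine le_trans (mul_le_mul_of_nonneg_right ?_ (by norm_num))
    (qq_bound c hr (σ := 0.866) (by norm_num) hd)
  rw [tt, qq]
  exact_mod_cast Nat.add_le_add (cnt_mono fun b h => tri_cap h) (cnt_mono fun b h => tri_cap h)

def BadP (c : Cfg V) (τ : ℝ) (p : V × V) : Prop := c.Bad τ p.1 p.2

lemma bad_count [Finite V] (c : Cfg V) (τ : ℝ) :
    cnt (c.BadP τ) + 2 * cnt (c.Good τ) ≤ cnt c.EP := by
  classical
  haveI : Fintype V := Fintype.ofFinite V
  have h1 : cnt (c.Good τ) ≤ cnt (fun p : V × V => c.ES τ p.1 p.2) := by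
    refine cnt_rel (fun b p => p.2 = b) ?_ ?_
    · rintro b ⟨a, h⟩
      have := h
      obtain ⟨s, r, h1, h2⟩ := this
      exact ⟨(s, b), ⟨⟨a, h⟩, h1⟩, rfl⟩
    · rintro b b' p - - h h'; exact h.symm.trans h'
  have h2 : cnt (c.Good τ) ≤ cnt (fun p : V × V => c.EC τ p.1 p.2) := by
    refine cnt_rel (fun b p => p.1 = b) ?_ ?_
    · rintro b ⟨a, h⟩
      have := h
      obtain ⟨s, r, h1, h2, -⟩ := this
      exact ⟨(b, r), ⟨⟨a, h⟩, h2⟩, rfl⟩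
    · rintro b b' p - - h h'; exact h.symm.trans h'
  have h3 : cnt (c.BadP τ) + cnt (fun p : V × V => c.ES τ p.1 p.2) +
      cnt (fun p : V × V => c.EC τ p.1 p.2) ≤ cnt c.EP := by
    rw [cnt_eq_sum, cnt_eq_sum, cnt_eq_sum, cnt_eq_sum, ← Finset.sum_add_distrib,
      ← Finset.sum_add_distrib]
    apply Finset.sum_le_sum
    rintro ⟨a, b⟩ -
    have k0 : c.BadP τ (a, b) ↔ c.E a b ∧ ¬ c.ES τ a b ∧ ¬ c.EC τ a b := Iff.rfl
    have k1 : c.EP (a, b) ↔ c.E a b := Iff.rfl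
    have k2 : c.ES τ a b → c.E a b := fun h => h.2.1
    have k3 : c.EC τ a b → c.E a b := fun h => h.2.1
    have k4 : c.ES τ a b → c.EC τ a b → False := by
      rintro ⟨⟨z, s, r, h1, -, -, -, h5, -⟩, h⟩ ⟨-, h'⟩
      obtain rfl := lu_unique h h1
      have := h'.2 z h5.2.1
      linarith [h5.2.2.1]
    simp only [k1]
    rw [if_congr k0 rfl rfl]
    split_ifs <;> simp_all
  omega

lemma bad_bound [Fintype V] (c : Cfg V) (τ : ℝ) :
    (2 * cnt (c.BadP τ) : ℝ) ≤ 25 * (4 * Fintype.card V - 2 * cnt c.EP + c.tt) + 4 * c.tt +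
      4 * c.qq τ ∧ (0 : ℝ) ≤ 4 * Fintype.card V - 2 * cnt c.EP + c.tt := by
  have h1 := bad_count c τ
  have h2 := fat_count c τ
  have h3 := rho_bound c
  have h4 := D_bound c
  have h5 : (2 * cnt (c.BadP τ) : ℤ) ≤ 25 * (4 * Fintype.card V - 2 * cnt c.EP + c.tt) + 4 * c.tt +
      4 * c.qq τ ∧ (0 : ℤ) ≤ 4 * Fintype.card V - 2 * cnt c.EP + c.tt := by
    constructor <;> omega
  exact_mod_cast h5

end Cfg

lemma cnt_prod {α : Type*} [Finite α] (X : ℕ) (Q : α → Prop) :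
    cnt (fun q : Fin X × α => Q q.2) = X * cnt Q := by
  have : {q : Fin X × α | Q q.2} = (Set.univ : Set (Fin X)) ×ˢ {a | Q a} := by
    ext q; simp
  rw [cnt, this, Set.ncard_prod, Set.ncard_univ, cnt]; simp

lemma cnt_exists_lt {α : Type*} [Finite α] (P : ℕ → α → Prop) (n : ℕ) :
    cnt (fun a => ∃ k < n, P k a) ≤ ∑ k ∈ Finset.range n, cnt (P k) := by
  induction n with
  | zero => simp [cnt]
  | succ n ih =>
    rw [Finset.sum_range_succ]
    refine (cnt_le_or (Q := fun a => ∃ k < n, P k a) (R := P n) ?_).trans (Nat.add_le_add_right ih _)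
    rintro a ⟨k, hk, h⟩
    rcases Nat.lt_succ_iff_lt_or_eq.1 hk with h1 | rfl
    · exact Or.inl ⟨k, h1, h⟩
    · exact Or.inr h

namespace Cfg
variable {V : Type*} {c : Cfg V}

/-- number of right neighbours of `a` above `b` -/
noncomputable def A (c : Cfg V) (a b : V) : ℕ := cnt (fun d => c.E a d ∧ c.y b < c.y d)
/-- number of left neighbours of `b` above `a` -/
noncomputable def B (c : Cfg V) (a b : V) : ℕ := cnt (fun d => c.E d b ∧ c.y a < c.y d)

lemma A_mx (a b : V) : c.mx.A a b = c.B b a := by simp only [A, B, E_mx, y_mx]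
lemma B_mx (a b : V) : c.mx.B a b = c.A b a := by simp only [A, B, E_mx, y_mx]

lemma B_lt [Finite V] {a a' b : V} (e' : c.E a' b) (hy : c.y a < c.y a') :
    c.B a' b < c.B a b := by
  apply Set.ncard_lt_ncard _ (Set.toFinite _)
  refine ⟨fun d hd => ⟨hd.1, hy.trans hd.2⟩, fun h => ?_⟩
  have := h (show a' ∈ {d | c.E d b ∧ c.y a < c.y d} from ⟨e', hy⟩)
  exact lt_irrefl _ this.2

lemma B_inj [Finite V] {a a' b : V} (e : c.E a b) (e' : c.E a' b) (h : c.B a b = c.B a' b) :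
    a = a' := by
  rcases lt_trichotomy (c.y a) (c.y a') with hy | hy | hy
  · have := B_lt e' hy; omega
  · exact left_inj e e' hy
  · have := B_lt e hy; omega

lemma B_nxt [Finite V] {b z r : V} (h : c.nxtL r b z) : c.B b r = c.B z r + 1 := by
  have : {d | c.E d r ∧ c.y b < c.y d} = insert z {d | c.E d r ∧ c.y z < c.y d} := by
    ext d
    simp only [Set.mem_ofPred_eq, Set.mem_insert_iff]
    constructor
    · rintro ⟨h1, h2⟩
      rcases lt_trichotomy (c.y d) (c.y z) with hy | hy | hy
      · exact absurd ⟨h2, hy⟩ (h.2.2.2 d h1)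
      · exact Or.inl (left_inj h1 h.2.1 hy)
      · exact Or.inr ⟨h1, hy⟩
    · rintro (rfl | ⟨h1, h2⟩)
      · exact ⟨h.2.1, h.2.2.1⟩
      · exact ⟨h1, h.2.2.1.trans h2⟩
  rw [B, cnt, this, Set.ncard_insert_of_notMem _ (Set.toFinite _)]
  · rfl
  · intro hh; exact lt_irrefl _ hh.2

lemma A_nxt [Finite V] {s b z : V} (h : c.nxtR s b z) : c.A s b = c.A s z + 1 := by
  have := B_nxt (c := c.mx) (b := b) (z := z) (r := s) (nxtL_mx.2 h)
  rwa [B_mx, B_mx] at this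

lemma lu_B {a b : V} (h : c.lu a b) : c.B a b = 0 := by
  have : {d | c.E d b ∧ c.y a < c.y d} = ∅ := by
    ext d
    simp only [Set.mem_ofPred_eq, Set.mem_empty_iff_false, iff_false]
    rintro ⟨h1, h2⟩
    have := h.2 d h1
    linarith
  rw [B, cnt, this, Set.ncard_empty]
lemma B_lu [Finite V] {a b : V} (e : c.E a b) (h : c.B a b = 0) : c.lu a b := by
  refine ⟨e, fun d hd => ?_⟩
  by_contra hh
  push Not at hh
  have := B_lt hd hh
  omega
lemma ru_A {a b : V} (h : c.ru a b) : c.A a b = 0 := by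
  have := lu_B (c := c.mx) (lu_mx.2 h)
  rwa [B_mx] at this

/-- edges from which a bad edge is reached in `k` steps to the right -/
def RE (c : Cfg V) (τ : ℝ) (X : ℕ) : ℕ → V → V → Prop
  | 0 => fun a b => c.Bad τ a b ∨ (c.E a b ∧ c.B a b < X ∧ ∃ a', c.y a ≤ c.y a' ∧ c.Bad τ a' b)
  | k + 1 => fun a b => c.E a b ∧ c.B a b < X ∧ ∃ d, RE c τ X k b d

lemma RE_count [Finite V] (c : Cfg V) (τ : ℝ) (X k : ℕ) :
    cnt (fun p : V × V => c.RE τ X k p.1 p.2) ≤ X ^ k * ((X + 1) * cnt (c.BadP τ)) := by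
  induction k with
  | zero =>
    refine (cnt_le_or (Q := c.BadP τ) (R := fun p : V × V => c.E p.1 p.2 ∧ c.B p.1 p.2 < X ∧
      ∃ a', c.y p.1 ≤ c.y a' ∧ c.Bad τ a' p.2) (fun p h => h)).trans ?_
    have : cnt (fun p : V × V => c.E p.1 p.2 ∧ c.B p.1 p.2 < X ∧
      ∃ a', c.y p.1 ≤ c.y a' ∧ c.Bad τ a' p.2) ≤ cnt (fun q : Fin X × (V × V) => c.BadP τ q.2) := by
      refine cnt_rel (fun p q => c.B p.1 p.2 = q.1 ∧ p.2 = q.2.2) ?_ ?_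
      · rintro ⟨a, b⟩ ⟨h1, h2, a', h3, h4⟩
        exact ⟨(⟨_, h2⟩, (a', b)), h4, rfl, rfl⟩
      · rintro ⟨a, b⟩ ⟨a', b'⟩ ⟨i, u, v⟩ ⟨e, -⟩ ⟨e', -⟩ ⟨h1, h2⟩ ⟨h3, h4⟩
        simp only at h1 h2 h3 h4 e e'
        subst h2 h4
        rw [B_inj e e' (h1.trans h3.symm)]
    rw [cnt_prod] at this
    rw [pow_zero, one_mul, add_mul, one_mul]
    omega
  | succ k ih =>
    have : cnt (fun p : V × V => c.RE τ X (k + 1) p.1 p.2) ≤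
        cnt (fun q : Fin X × (V × V) => c.RE τ X k q.2.1 q.2.2) := by
      refine cnt_rel (fun p q => c.B p.1 p.2 = q.1 ∧ p.2 = q.2.1) ?_ ?_
      · rintro ⟨a, b⟩ ⟨h1, h2, d, h3⟩
        exact ⟨(⟨_, h2⟩, (b, d)), h3, rfl, rfl⟩
      · rintro ⟨a, b⟩ ⟨a', b'⟩ ⟨i, u, v⟩ ⟨e, -⟩ ⟨e', -⟩ ⟨h1, h2⟩ ⟨h3, h4⟩
        simp only at h1 h2 h3 h4 e e'
        subst h2 h4
        rw [B_inj e e' (h1.trans h3.symm)]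
    rw [cnt_prod X (fun q : V × V => c.RE τ X k q.1 q.2)] at this
    calc _ ≤ _ := this
      _ ≤ X * (X ^ k * ((X + 1) * cnt (c.BadP τ))) := Nat.mul_le_mul_left _ ih
      _ = _ := by ring

lemma BadP_mx [Finite V] (c : Cfg V) (τ : ℝ) : cnt (c.mx.BadP τ) ≤ cnt (c.BadP τ) := by
  refine cnt_rel (fun p q => p = q.swap) ?_ ?_
  · rintro ⟨a, b⟩ h; exact ⟨(b, a), Bad_mx.1 h, rfl⟩
  · rintro p p' q - - rfl rfl; rfl

/-- edges from which a bad edge is reached directly -/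
def Esc (c : Cfg V) (τ : ℝ) (X : ℕ) (a b : V) : Prop := ∃ k < X, c.RE τ X k a b ∨ c.mx.RE τ X k b a

def ESC (c : Cfg V) (τ : ℝ) (X : ℕ) : ℕ → V → V → Prop
  | 0 => c.Esc τ X
  | n + 1 => fun a b => ESC c τ X n a b ∨ (∃ z, c.RhT τ a z ∧ ESC c τ X n z b) ∨
      (∃ z, c.RhT τ b z ∧ ESC c τ X n a z)

lemma Esc_mx {τ : ℝ} {X : ℕ} {a b : V} : c.mx.Esc τ X b a ↔ c.Esc τ X a b := by
  simp only [Esc, mx_mx]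
  constructor
  · rintro ⟨k, hk, h⟩; exact ⟨k, hk, h.symm⟩
  · rintro ⟨k, hk, h⟩; exact ⟨k, hk, h.symm⟩

lemma ESC_mx {τ : ℝ} {X : ℕ} {n : ℕ} : ∀ {a b : V}, c.mx.ESC τ X n b a ↔ c.ESC τ X n a b := by
  induction n with
  | zero => exact Esc_mx
  | succ n ih =>
    intro a b
    simp only [ESC, ih, RhT_mx]
    constructor
    · rintro (h | h | h)
      exacts [Or.inl h, Or.inr (Or.inr h), Or.inr (Or.inl h)]
    · rintro (h | h | h)
      exacts [Or.inl h, Or.inr (Or.inr h), Or.inr (Or.inl h)]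

lemma ESC_zero {τ : ℝ} {X : ℕ} {a b : V} (h : c.Esc τ X a b) : ∀ n, c.ESC τ X n a b
  | 0 => h
  | n + 1 => Or.inl (ESC_zero h n)

lemma Esc_count [Finite V] (c : Cfg V) (τ : ℝ) (X : ℕ) :
    cnt (fun p : V × V => c.Esc τ X p.1 p.2) ≤
      (2 * (X + 1) * ∑ k ∈ Finset.range X, X ^ k) * cnt (c.BadP τ) := by
  refine (cnt_exists_lt (fun k (p : V × V) => c.RE τ X k p.1 p.2 ∨ c.mx.RE τ X k p.2 p.1) X).trans ?_
  rw [mul_assoc, mul_comm (∑ k ∈ Finset.range X, X ^ k), ← mul_assoc, Finset.mul_sum]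
  apply Finset.sum_le_sum
  intro k _
  refine (cnt_or _ _).trans ?_
  have h1 := RE_count c τ X k
  have h2 := RE_count c.mx τ X k
  have h3 : cnt (fun p : V × V => c.mx.RE τ X k p.2 p.1) ≤
      cnt (fun p : V × V => c.mx.RE τ X k p.1 p.2) := by
    refine cnt_rel (fun p q => p = q.swap) ?_ ?_
    · rintro ⟨a, b⟩ h; exact ⟨(b, a), h, rfl⟩
    · rintro p p' q - - rfl rfl; rfl
  have h4 : X ^ k * ((X + 1) * cnt (c.mx.BadP τ)) ≤ X ^ k * ((X + 1) * cnt (c.BadP τ)) :=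
    Nat.mul_le_mul_left _ (Nat.mul_le_mul_left _ (BadP_mx c τ))
  calc _ ≤ X ^ k * ((X + 1) * cnt (c.BadP τ)) + X ^ k * ((X + 1) * cnt (c.BadP τ)) :=
        Nat.add_le_add h1 (h3.trans (h2.trans h4))
    _ = _ := by ring

lemma ESC_count [Finite V] (c : Cfg V) (τ : ℝ) (X n : ℕ) :
    cnt (fun p : V × V => c.ESC τ X n p.1 p.2) ≤
      3 ^ n * ((2 * (X + 1) * ∑ k ∈ Finset.range X, X ^ k) * cnt (c.BadP τ)) := by
  induction n with
  | zero => rw [pow_zero, one_mul]; exact Esc_count c τ X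
  | succ n ih =>
    have k1 : cnt (fun p : V × V => ∃ z, c.RhT τ p.1 z ∧ c.ESC τ X n z p.2) ≤
        cnt (fun p : V × V => c.ESC τ X n p.1 p.2) := by
      refine cnt_rel (fun p q => c.RhT τ p.1 q.1 ∧ p.2 = q.2) ?_ ?_
      · rintro ⟨a, b⟩ ⟨z, h1, h2⟩; exact ⟨(z, b), h2, h1, rfl⟩
      · rintro ⟨a, b⟩ ⟨a', b'⟩ ⟨z, w⟩ - - ⟨h1, h2⟩ ⟨h3, h4⟩
        simp only at h1 h2 h3 h4
        rw [h1.W.unique' h3.W, h2, h4]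
    have k2 : cnt (fun p : V × V => ∃ z, c.RhT τ p.2 z ∧ c.ESC τ X n p.1 z) ≤
        cnt (fun p : V × V => c.ESC τ X n p.1 p.2) := by
      refine cnt_rel (fun p q => c.RhT τ p.2 q.2 ∧ p.1 = q.1) ?_ ?_
      · rintro ⟨a, b⟩ ⟨z, h1, h2⟩; exact ⟨(a, z), h2, h1, rfl⟩
      · rintro ⟨a, b⟩ ⟨a', b'⟩ ⟨z, w⟩ - - ⟨h1, h2⟩ ⟨h3, h4⟩
        simp only at h1 h2 h3 h4
        rw [h1.W.unique' h3.W, h2, h4]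
    have : cnt (fun p : V × V => c.ESC τ X (n + 1) p.1 p.2) ≤
        cnt (fun p : V × V => c.ESC τ X n p.1 p.2) +
        (cnt (fun p : V × V => ∃ z, c.RhT τ p.1 z ∧ c.ESC τ X n z p.2) +
        cnt (fun p : V × V => ∃ z, c.RhT τ p.2 z ∧ c.ESC τ X n p.1 z)) :=
      (cnt_or _ _).trans (Nat.add_le_add_left (cnt_or _ _) _)
    rw [pow_succ]
    nlinarith

end Cfg

lemma thin_aux {e1 e2 w1 w2 τ : ℝ} (he : e1 ^ 2 + e2 ^ 2 = 1) (hw : w1 ^ 2 + w2 ^ 2 = 1)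
    (e0 : 0 < e1) (w0 : 0 < w1) (h : |e2| ≤ 0.8) (hk : |e1 * w2 - e2 * w1| ≤ τ) (ht : τ ≤ 0.032) :
    |w2 - e2| ≤ 1.01 * τ := by
  have hτ : 0 ≤ τ := (abs_nonneg _).trans hk
  set κ := e1 * w2 - e2 * w1 with hκ
  set δ := e1 * w1 + e2 * w2 with hδ
  have id : δ ^ 2 + κ ^ 2 = 1 := by
    have : δ ^ 2 + κ ^ 2 = (e1 ^ 2 + e2 ^ 2) * (w1 ^ 2 + w2 ^ 2) := by rw [hκ, hδ]; ring
    rw [this, he, hw]; norm_num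
  have hk2 : κ ^ 2 ≤ τ ^ 2 := sq_le_sq' (by linarith [(abs_le.1 hk).1]) (abs_le.1 hk).2
  have hk3 : κ ^ 2 ≤ 0.032 ^ 2 := hk2.trans (by gcongr)
  have hw1 : w1 = δ * e1 - κ * e2 := by
    rw [hκ, hδ]; linear_combination (-w1) * he
  have he2 := abs_le.1 h
  have he1 : 0.6 ≤ e1 := by
    by_contra hh; push Not at hh
    nlinarith
  have hδ0 : 0 < δ := by
    by_contra hh; push Not at hh
    have h1 : δ ≤ -0.9 := by nlinarith
    have h2 : |κ * e2| ≤ 0.032 * 0.8 := by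
      rw [abs_mul]; exact mul_le_mul (hk.trans ht) h (abs_nonneg _) (by norm_num)
    have := abs_le.1 h2
    nlinarith
  have hδ1 : 0.998 ≤ δ := by nlinarith
  have hd : (w2 - e2) ^ 2 ≤ 2 * (1 - δ) := by
    have : (w2 - e2) ^ 2 + (w1 - e1) ^ 2 = 2 * (1 - δ) := by rw [hδ]; linear_combination he + hw
    nlinarith [sq_nonneg (w1 - e1)]
  have : (w2 - e2) ^ 2 ≤ (1.01 * τ) ^ 2 := by nlinarith
  exact abs_le_of_sq_le_sq this (by positivity)

namespace Cfg
variable {V : Type*} {c : Cfg V}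

lemma drift [Finite V] {τ : ℝ} (hτ : τ ≤ 0.032) (hτ0 : 0 < τ) : ∀ (n : ℕ) (a b : V), c.E a b →
    c.B a b = n → (∀ a', c.y a ≤ c.y a' → ¬ c.Bad τ a' b) →
    |c.y b - c.y a| + n * (1.01 * τ) ≤ 0.8 →
    ∃ r, c.ru b r ∧ |(c.y r - c.y b) - (c.y b - c.y a)| ≤ (n + 1) * (1.01 * τ) := by
  intro n
  induction n with
  | zero =>
    intro a b e hB hbad hy
    have h1 := hbad a le_rfl
    by_cases hES : c.ES τ a b
    · obtain ⟨⟨z, s, r, g1, g2, g3, g4, g5, g6, g7⟩, hl⟩ := hES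
      obtain rfl : s = a := lu_unique g1 hl
      refine ⟨r, g2, ?_⟩
      have sp := sq_para g1.1 g2.1 g3.1 g4.1 (by rintro rfl; exact lt_irrefl _ g5.2.2.1)
      have l1 := g1.1.lt
      have l2 := g3.1.lt
      have := thin_aux (w1 := c.x z - c.x s) (w2 := c.y z - c.y s) g1.1.sq g3.1.sq (by linarith)
        (by linarith) (τ := τ) (by push_cast at hy; linarith) (by
          rw [abs_of_nonneg]
          · exact g7.le
          · have := slope_aux (by linarith) (by linarith) g1.1.sq g3.1.sq (by linarith [g5.2.2.1])
            linarith) hτ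
      have e : (c.y r - c.y b) - (c.y b - c.y s) = (c.y z - c.y s) - (c.y b - c.y s) := by
        linarith [sp.2]
      rw [e]; push_cast; linarith
    · exfalso
      have hEC : c.EC τ a b := by
        by_contra h2; exact h1 ⟨e, hES, h2⟩
      obtain ⟨⟨z, s, r, g1, g2, g3, g4, g5, g6, g7⟩, hl⟩ := hEC
      obtain rfl : r = b := ru_unique g2 hl
      have := B_nxt g6
      omega
  | succ n ih =>
    intro a b e hB hbad hy
    have h1 := hbad a le_rfl
    by_cases hES : c.ES τ a b
    · have := lu_B hES.2
      omega
    · have hEC : c.EC τ a b := by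
        by_contra h2; exact h1 ⟨e, hES, h2⟩
      obtain ⟨⟨z, s, r, g1, g2, g3, g4, g5, g6, g7⟩, hl⟩ := hEC
      obtain rfl : r = b := ru_unique g2 hl
      have hB' := B_nxt g6
      have sp := sq_para g1.1 g2.1 g3.1 g4.1 (by rintro rfl; exact lt_irrefl _ g5.2.2.1)
      have l1 := g2.1.lt
      have l2 := g4.1.lt
      have l3 := g1.1.lt
      have l4 := g3.1.lt
      push_cast at hy
      have key := thin_aux (w1 := c.x r - c.x z) (w2 := c.y r - c.y z) g2.1.sq g4.1.sq (by linarith)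
        (by linarith) (τ := τ) (by nlinarith [n.cast_nonneg (α := ℝ)]) (by
          have hc : (c.x r - c.x a) * (c.y r - c.y z) - (c.y r - c.y a) * (c.x r - c.x z) =
            - c.cr s a z := by
            rw [cr]
            have e1 : c.x r = c.x a + c.x z - c.x s := by linarith [sp.1]
            have e2 : c.y r = c.y a + c.y z - c.y s := by linarith [sp.2]
            rw [e1, e2]; ring
          rw [hc, abs_neg, abs_of_nonneg]
          · exact g7.le
          · have := slope_aux (by linarith) (by linarith) g1.1.sq g3.1.sq (by linarith [g5.2.2.1])
            simp only [cr]; linarith) hτ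
      have hlt := g6.2.2.1
      have tri : |c.y r - c.y z| ≤ |c.y r - c.y a| + 1.01 * τ := by
        have := abs_add_le ((c.y r - c.y z) - (c.y r - c.y a)) (c.y r - c.y a)
        rw [sub_add_cancel] at this
        linarith
      obtain ⟨q, hq, hq2⟩ := ih z r g4.1 (by omega) (fun a' h => hbad a' (by linarith)) (by linarith)
      refine ⟨q, hq, ?_⟩
      have := abs_add_le ((c.y q - c.y r) - (c.y r - c.y z)) ((c.y r - c.y z) - (c.y r - c.y a))
      rw [sub_add_sub_cancel] at this
      push_cast; linarith

lemma dx_of_dy {a b : V} (e : c.E a b) (h : |c.y b - c.y a| ≤ 0.8) : 0.6 ≤ c.x b - c.x a := by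
  have := e.sq
  have := e.lt
  have := abs_le.1 h
  by_contra hh; push Not at hh
  nlinarith

/-- a path going right, ending in an edge of high index -/
def RPath (c : Cfg V) (X : ℕ) (f : ℕ → V) (n : ℕ) : Prop :=
  (∀ i ≤ n, c.E (f i) (f (i + 1)) ∧ 0.6 ≤ c.x (f (i + 1)) - c.x (f i)) ∧
  (∀ i < n, c.B (f i) (f (i + 1)) < X) ∧ X ≤ c.B (f n) (f (n + 1))

lemma extend [Finite V] {τ : ℝ} {X : ℕ} (hτ : τ ≤ 0.032) (hτ0 : 0 < τ) : ∀ (j : ℕ) (a b : V), c.E a b →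
    |c.y b - c.y a| + (j + 1) * (X * (1.01 * τ)) ≤ 0.8 → (∀ k ≤ j, ¬ c.RE τ X k a b) →
    (∀ v, c.x v - c.x b < 0.6 * (j + 1)) →
    ∃ f n, f 0 = a ∧ f 1 = b ∧ c.RPath X f n := by
  intro j
  induction j with
  | zero =>
    intro a b e hy hre hx
    have hX0 : (0 : ℝ) ≤ X * (1.01 * τ) := by positivity
    by_cases hB : X ≤ c.B a b
    · refine ⟨fun i => if i = 0 then a else b, 0, rfl, rfl, ?_, ?_, ?_⟩
      · intro i hi
        obtain rfl : i = 0 := by omega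
        have hy2 : |c.y b - c.y a| ≤ 0.8 := by push_cast at hy; linarith
        exact ⟨e, dx_of_dy e hy2⟩
      · intro i hi; omega
      · exact hB
    · exfalso
      push Not at hB
      have hB' : (c.B a b : ℝ) + 1 ≤ X := by exact_mod_cast hB
      have h0 := hre 0 (Nat.zero_le _)
      push_cast at hy
      obtain ⟨r, hr, hr2⟩ := drift hτ hτ0 _ a b e rfl (fun a' h1 h2 => h0 (Or.inr ⟨e, hB, a', h1, h2⟩))
        (by nlinarith)
      have := abs_add_le ((c.y r - c.y b) - (c.y b - c.y a)) (c.y b - c.y a)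
      rw [sub_add_cancel] at this
      have h3 := dx_of_dy hr.1 (by nlinarith)
      have := hx r
      push_cast at this
      linarith
  | succ j ih =>
    intro a b e hy hre hx
    have hX0 : (0 : ℝ) ≤ X * (1.01 * τ) := by positivity
    have hX1 : (0 : ℝ) ≤ j * (X * (1.01 * τ)) := by positivity
    by_cases hB : X ≤ c.B a b
    · refine ⟨fun i => if i = 0 then a else b, 0, rfl, rfl, ?_, ?_, ?_⟩
      · intro i hi
        obtain rfl : i = 0 := by omega
        have hy2 : |c.y b - c.y a| ≤ 0.8 := by push_cast at hy; linarith
        exact ⟨e, dx_of_dy e hy2⟩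
      · intro i hi; omega
      · exact hB
    · push Not at hB
      have hB' : (c.B a b : ℝ) + 1 ≤ X := by exact_mod_cast hB
      have h0 := hre 0 (Nat.zero_le _)
      push_cast at hy
      obtain ⟨r, hr, hr2⟩ := drift hτ hτ0 _ a b e rfl (fun a' h1 h2 => h0 (Or.inr ⟨e, hB, a', h1, h2⟩))
        (by nlinarith)
      have := abs_add_le ((c.y r - c.y b) - (c.y b - c.y a)) (c.y b - c.y a)
      rw [sub_add_cancel] at this
      have hh : |c.y r - c.y b| ≤ |c.y b - c.y a| + X * (1.01 * τ) := by nlinarith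
      have h3 := dx_of_dy hr.1 (by linarith)
      obtain ⟨f, n, f0, f1, g1, g2, g3⟩ := ih b r hr.1 (by linarith)
        (fun k hk h => hre (k + 1) (by omega) ⟨e, hB, r, h⟩)
        (fun v => by have := hx v; push_cast at this; linarith)
      refine ⟨fun i => if i = 0 then a else f (i - 1), n + 1, rfl, f0, ?_, ?_, ?_⟩
      · intro i hi
        rcases i with _ | i
        · simp only [zero_add, if_true, one_ne_zero, if_false, Nat.sub_self, f0]
          exact ⟨e, dx_of_dy e (by linarith)⟩
        · exact g1 i (by omega)
      · intro i hi
        rcases i with _ | i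
        · simp only [zero_add, if_true, one_ne_zero, if_false, Nat.sub_self, f0]
          exact hB
        · exact g2 i (by omega)
      · exact g3

lemma extend' [Finite V] {τ : ℝ} {X : ℕ} (hτ : τ ≤ 0.032) (hτ0 : 0 < τ) (hX : 1 ≤ X)
    (hXτ : (X : ℝ) ^ 2 * (1.01 * τ) ≤ 0.092) (hd : ∀ u v, c.x v - c.x u < 0.6 * (X + 1))
    {a b : V} (e : c.E a b) (hy : (c.y b - c.y a) ^ 2 ≤ 1 / 2) (hre : ∀ k < X, ¬ c.RE τ X k a b) :
    ∃ f n, f 0 = a ∧ f 1 = b ∧ c.RPath X f n := by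
  have hy' : |c.y b - c.y a| ≤ 0.708 := abs_le_of_sq_le_sq (by norm_num; linarith) (by norm_num)
  obtain ⟨j, rfl⟩ : ∃ j, X = j + 1 := ⟨X - 1, by omega⟩
  have h3 := dx_of_dy e (by linarith)
  refine extend hτ hτ0 j a b e ?_ (fun k hk => hre k (by omega)) ?_
  · push_cast at hXτ ⊢
    nlinarith
  · intro v
    have := hd a v
    push_cast at this
    linarith
end Cfg

/-- number of indices with smaller value -/
noncomputable def clt (g : ℤ → ℝ) (lo hi : ℤ) (t : ℝ) : ℕ := ((Finset.Ico lo hi).filter (fun k => g k < t)).card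
/-- number of indices with larger value -/
noncomputable def cgt (g : ℤ → ℝ) (lo hi : ℤ) (t : ℝ) : ℕ := ((Finset.Ico lo hi).filter (fun k => t < g k)).card
/-- number of increasing pairs -/
noncomputable def inv (g : ℤ → ℝ) (lo hi : ℤ) : ℕ :=
  ((Finset.Ico lo hi ×ˢ Finset.Ico lo hi).filter (fun q => q.1 < q.2 ∧ g q.1 < g q.2)).card

lemma clt_neg {g g' : ℤ → ℝ} (h : ∀ k, g' k = - g (-k)) (lo hi : ℤ) (t : ℝ) :
    clt g' (1 - hi) (1 - lo) t = cgt g lo hi (-t) := by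
  refine Finset.card_equiv (Equiv.neg ℤ) fun k => ?_
  simp only [Finset.mem_filter, Finset.mem_Ico, Equiv.neg_apply, h]
  constructor
  · rintro ⟨⟨h1, h2⟩, h3⟩; exact ⟨⟨by omega, by omega⟩, by linarith⟩
  · rintro ⟨⟨h1, h2⟩, h3⟩; exact ⟨⟨by omega, by omega⟩, by linarith⟩

lemma cgt_neg {g g' : ℤ → ℝ} (h : ∀ k, g' k = - g (-k)) (lo hi : ℤ) (t : ℝ) :
    cgt g' (1 - hi) (1 - lo) t = clt g lo hi (-t) := by
  refine Finset.card_equiv (Equiv.neg ℤ) fun k => ?_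
  simp only [Finset.mem_filter, Finset.mem_Ico, Equiv.neg_apply, h]
  constructor
  · rintro ⟨⟨h1, h2⟩, h3⟩; exact ⟨⟨by omega, by omega⟩, by linarith⟩
  · rintro ⟨⟨h1, h2⟩, h3⟩; exact ⟨⟨by omega, by omega⟩, by linarith⟩

lemma inv_neg' {g g' : ℤ → ℝ} (h : ∀ k, g' k = - g (-k)) (lo hi : ℤ) :
    inv g' (1 - hi) (1 - lo) = inv g lo hi := by
  refine Finset.card_equiv ((Equiv.prodComm ℤ ℤ).trans ((Equiv.neg ℤ).prodCongr (Equiv.neg ℤ))) fun k => ?_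
  obtain ⟨j, k⟩ := k
  simp only [Finset.mem_filter, Finset.mem_product, Finset.mem_Ico, Equiv.trans_apply, Equiv.prodComm_apply,
    Prod.swap_prod_mk, Equiv.prodCongr_apply, Prod.map_apply, Equiv.neg_apply, h]
  constructor
  · rintro ⟨⟨⟨h1, h2⟩, h3, h4⟩, h5, h6⟩
    exact ⟨⟨⟨by omega, by omega⟩, by omega, by omega⟩, by omega, by linarith⟩
  · rintro ⟨⟨⟨h1, h2⟩, h3, h4⟩, h5, h6⟩
    exact ⟨⟨⟨by omega, by omega⟩, by omega, by omega⟩, by omega, by linarith⟩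

lemma clt_le (g : ℤ → ℝ) {lo hi k : ℤ} (h1 : lo ≤ k) (h2 : k < hi) :
    (1 + clt g lo hi (g k) : ℤ) ≤ hi - lo := by
  have : clt g lo hi (g k) < (Finset.Ico lo hi).card := by
    apply Finset.card_lt_card
    refine ⟨Finset.filter_subset _ _, fun h => ?_⟩
    have := h (Finset.mem_Ico.2 ⟨h1, h2⟩)
    exact lt_irrefl _ (Finset.mem_filter.1 this).2
  rw [Int.card_Ico] at this
  omega

lemma cgt_le (g : ℤ → ℝ) {lo hi k : ℤ} (h1 : lo ≤ k) (h2 : k < hi) :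
    (1 + cgt g lo hi (g k) : ℤ) ≤ hi - lo := by
  have : cgt g lo hi (g k) < (Finset.Ico lo hi).card := by
    apply Finset.card_lt_card
    refine ⟨Finset.filter_subset _ _, fun h => ?_⟩
    have := h (Finset.mem_Ico.2 ⟨h1, h2⟩)
    exact lt_irrefl _ (Finset.mem_filter.1 this).2
  rw [Int.card_Ico] at this
  omega

lemma cgt_mono (g : ℤ → ℝ) {lo hi hi' : ℤ} (h : hi' ≤ hi) (t : ℝ) : cgt g lo hi' t ≤ cgt g lo hi t :=
  Finset.card_le_card (Finset.filter_subset_filter _ (Finset.Ico_subset_Ico le_rfl h))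

lemma inv_mono (g : ℤ → ℝ) {lo hi hi' : ℤ} (h : hi' ≤ hi) : inv g lo hi' ≤ inv g lo hi :=
  Finset.card_le_card (Finset.filter_subset_filter _
    (Finset.product_subset_product (Finset.Ico_subset_Ico le_rfl h) (Finset.Ico_subset_Ico le_rfl h)))

lemma inv_le (g : ℤ → ℝ) {lo hi : ℤ} {X : ℕ} (h : hi - lo ≤ X) : inv g lo hi ≤ X * (X - 1) / 2 := by
  rw [Nat.le_div_iff_mul_le (by norm_num)]
  set S := (Finset.Ico lo hi ×ˢ Finset.Ico lo hi).filter (fun q => q.1 < q.2 ∧ g q.1 < g q.2) with hS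
  have e : inv g lo hi = S.card := rfl
  have e2 : inv g lo hi = (S.image Prod.swap).card := by
    rw [Finset.card_image_of_injective _ Prod.swap_injective, e]
  have hd : Disjoint S (S.image Prod.swap) := by
    rw [Finset.disjoint_left]
    rintro ⟨a, b⟩ h1 h2
    simp only [hS, Finset.mem_image, Finset.mem_filter, Prod.exists, Prod.swap_prod_mk, Prod.mk.injEq] at h1 h2
    obtain ⟨a', b', h3, rfl, rfl⟩ := h2
    omega
  have hsub : S ∪ S.image Prod.swap ⊆ (Finset.Ico lo hi).offDiag := by
    rintro ⟨a, b⟩ h1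
    simp only [hS, Finset.mem_union, Finset.mem_image, Finset.mem_filter, Prod.exists, Prod.swap_prod_mk,
      Prod.mk.injEq, Finset.mem_product, Finset.mem_offDiag] at h1 ⊢
    rcases h1 with h1 | ⟨a', b', h1, rfl, rfl⟩
    · exact ⟨h1.1.1, h1.1.2, by omega⟩
    · exact ⟨h1.1.2, h1.1.1, by omega⟩
  have := Finset.card_le_card hsub
  rw [Finset.card_union_of_disjoint hd, ← e, ← e2, Finset.offDiag_card, Int.card_Ico] at this
  have hn : (hi - lo).toNat ≤ X := by omega
  calc inv g lo hi * 2 ≤ (hi - lo).toNat * (hi - lo).toNat - (hi - lo).toNat := by omega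
    _ = (hi - lo).toNat * ((hi - lo).toNat - 1) := by rw [Nat.mul_sub, mul_one]
    _ ≤ _ := Nat.mul_le_mul hn (by omega)

section swp
variable {g g' : ℤ → ℝ} {m lo hi : ℤ}

lemma swp_eq (h1 : g' m = g (m + 1)) (h2 : g' (m + 1) = g m) (h3 : ∀ k, k ≠ m → k ≠ m + 1 → g' k = g k) (k : ℤ) :
    g' k = g (Equiv.swap m (m + 1) k) := by
  by_cases e1 : k = m
  · rw [e1, Equiv.swap_apply_left, h1]
  by_cases e2 : k = m + 1
  · rw [e2, Equiv.swap_apply_right, h2]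
  rw [Equiv.swap_apply_of_ne_of_ne e1 e2, h3 k e1 e2]

lemma swp_cases (m k : ℤ) : (k = m ∧ Equiv.swap m (m + 1) k = m + 1) ∨ (k = m + 1 ∧ Equiv.swap m (m + 1) k = m) ∨
    (k ≠ m ∧ k ≠ m + 1 ∧ Equiv.swap m (m + 1) k = k) := by
  by_cases e1 : k = m
  · left; refine ⟨e1, ?_⟩; rw [e1, Equiv.swap_apply_left]
  by_cases e2 : k = m + 1
  · right; left; refine ⟨e2, ?_⟩; rw [e2, Equiv.swap_apply_right]
  right; right; exact ⟨e1, e2, Equiv.swap_apply_of_ne_of_ne e1 e2⟩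

lemma swp_mem (hl : lo ≤ m) (hh : m + 1 < hi) (k : ℤ) :
    Equiv.swap m (m + 1) k ∈ Finset.Ico lo hi ↔ k ∈ Finset.Ico lo hi := by
  simp only [Finset.mem_Ico]
  rcases swp_cases m k with ⟨h1, h2⟩ | ⟨h1, h2⟩ | ⟨h1, h1', h2⟩ <;> rw [h2] <;> omega

lemma clt_swp (h : ∀ k, g' k = g (Equiv.swap m (m + 1) k)) (hl : lo ≤ m) (hh : m + 1 < hi) (t : ℝ) :
    clt g' lo hi t = clt g lo hi t := by
  refine Finset.card_equiv (Equiv.swap m (m + 1)) fun k => ?_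
  rw [Finset.mem_filter, Finset.mem_filter, swp_mem hl hh, h]

lemma cgt_swp (h : ∀ k, g' k = g (Equiv.swap m (m + 1) k)) (hl : lo ≤ m) (hh : m + 1 < hi) (t : ℝ) :
    cgt g' lo hi t = cgt g lo hi t := by
  refine Finset.card_equiv (Equiv.swap m (m + 1)) fun k => ?_
  rw [Finset.mem_filter, Finset.mem_filter, swp_mem hl hh, h]

lemma inv_swp (h : ∀ k, g' k = g (Equiv.swap m (m + 1) k)) (hl : lo ≤ m) (hh : m + 1 < hi)
    (hg : g m < g (m + 1)) : inv g' lo hi + 1 ≤ inv g lo hi := by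
  have hm : (m, m + 1) ∈ (Finset.Ico lo hi ×ˢ Finset.Ico lo hi).filter
      (fun q => q.1 < q.2 ∧ g q.1 < g q.2) := by
    simp only [Finset.mem_filter, Finset.mem_product, Finset.mem_Ico]
    exact ⟨⟨⟨hl, by omega⟩, by omega, hh⟩, by omega, hg⟩
  have hc := Finset.card_erase_add_one hm
  have : inv g' lo hi ≤ (((Finset.Ico lo hi ×ˢ Finset.Ico lo hi).filter
      (fun q => q.1 < q.2 ∧ g q.1 < g q.2)).erase (m, m + 1)).card := by
    refine Finset.card_le_card_of_injOn
      (fun q => (Equiv.swap m (m + 1) q.1, Equiv.swap m (m + 1) q.2)) ?_ ?_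
    · rintro ⟨j, k⟩ hq
      simp only [Finset.coe_filter, Finset.mem_product, Set.mem_ofPred_eq, h] at hq
      obtain ⟨⟨q1, q2⟩, q3, q4⟩ := hq
      simp only [Finset.coe_erase, Set.mem_sdiff, Finset.mem_coe, Finset.mem_filter, Finset.mem_product,
        swp_mem hl hh, Set.mem_singleton_iff, Prod.mk.injEq]
      rcases swp_cases m j with ⟨h1, h2⟩ | ⟨h1, h2⟩ | ⟨h1, h1', h2⟩ <;>
      rcases swp_cases m k with ⟨k1, k2⟩ | ⟨k1, k2⟩ | ⟨k1, k1', k2⟩ <;> rw [h2, k2] at q4 ⊢ <;>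
      first
      | (exfalso; omega)
      | (exfalso; linarith)
      | exact ⟨⟨⟨q1, q2⟩, by omega, q4⟩, by omega⟩
    · rintro ⟨j, k⟩ - ⟨j', k'⟩ - hq
      simpa using hq
  have e : inv g lo hi = ((Finset.Ico lo hi ×ˢ Finset.Ico lo hi).filter
      (fun q => q.1 < q.2 ∧ g q.1 < g q.2)).card := rfl
  omega
end swp

namespace Cfg
variable {V : Type*} {c : Cfg V}

def gg (c : Cfg V) (p : ℤ → V) (k : ℤ) : ℝ := c.y (p (k + 1)) - c.y (p k)

structure PathOK (c : Cfg V) (X : ℕ) (p : ℤ → V) (lo hi : ℤ) : Prop where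
  lo0 : lo ≤ 0
  hi1 : 1 ≤ hi
  len : hi - lo ≤ X
  edge : ∀ i, lo ≤ i → i < hi → c.E (p i) (p (i + 1))
  hB : ∀ i, 0 ≤ i → i + 1 < hi → c.B (p i) (p (i + 1)) < X
  hA : ∀ i, lo < i → i ≤ 0 → c.A (p i) (p (i + 1)) < X
  lastB : 1 + clt (c.gg p) lo hi (c.gg p (hi - 1)) ≤ c.B (p (hi - 1)) (p hi)
  firstA : 1 + cgt (c.gg p) lo hi (c.gg p lo) ≤ c.A (p lo) (p (lo + 1))

lemma gg_mx (p : ℤ → V) (k : ℤ) : c.mx.gg (fun i => p (1 - i)) k = - c.gg p (-k) := by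
  simp only [gg, y_mx]
  rw [show 1 - (k + 1) = -k by ring, show 1 - k = -k + 1 by ring]; ring

lemma PathOK.mirror {X : ℕ} {p : ℤ → V} {lo hi : ℤ} (P : c.PathOK X p lo hi) :
    c.mx.PathOK X (fun i => p (1 - i)) (1 - hi) (1 - lo) where
  lo0 := by have := P.hi1; omega
  hi1 := by have := P.lo0; omega
  len := by have := P.len; omega
  edge := fun i h1 h2 => by
    have := P.edge (-i) (by omega) (by omega)
    rw [E_mx]
    rwa [show 1 - (i + 1) = -i by ring, show 1 - i = -i + 1 by ring]
  hB := fun i h1 h2 => by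
    have := P.hA (-i) (by omega) (by omega)
    rw [B_mx]
    rwa [show 1 - (i + 1) = -i by ring, show 1 - i = -i + 1 by ring]
  hA := fun i h1 h2 => by
    have := P.hB (-i) (by omega) (by omega)
    rw [A_mx]
    rwa [show 1 - (i + 1) = -i by ring, show 1 - i = -i + 1 by ring]
  lastB := by
    rw [clt_neg (gg_mx p), gg_mx, B_mx, neg_neg, show -(1 - lo - 1) = lo by ring,
      show 1 - (1 - lo) = lo by ring, show 1 - (1 - lo - 1) = lo + 1 by ring]
    exact P.firstA
  firstA := by
    rw [cgt_neg (gg_mx p), gg_mx, A_mx, neg_neg, show -(1 - hi) = hi - 1 by ring,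
      show 1 - (1 - hi) = hi by ring, show 1 - (1 - hi + 1) = hi - 1 by ring]
    exact P.lastB

lemma PathOK.bad_right {X : ℕ} {p : ℤ → V} {lo hi : ℤ} (P : c.PathOK X p lo hi) {τ : ℝ} : ∀ (k : ℕ) (i : ℤ),
    0 ≤ i → i + k < hi → c.Bad τ (p (i + k)) (p (i + k + 1)) → c.RE τ X k (p i) (p (i + 1)) := by
  intro k
  induction k with
  | zero =>
    intro i h1 h2 h3
    left
    simpa using h3
  | succ k ih =>
    intro i h1 h2 h3
    push_cast at h2 h3
    have := P.lo0
    refine ⟨P.edge i (by omega) (by omega), P.hB i h1 (by omega), p (i + 1 + 1), ?_⟩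
    apply ih (i + 1) (by omega) (by omega)
    rwa [show i + 1 + (k : ℤ) = i + (k + 1) by ring]

lemma PathOK.bad_esc {X : ℕ} {p : ℤ → V} {lo hi : ℤ} (P : c.PathOK X p lo hi) {τ : ℝ} {j : ℤ}
    (h1 : lo ≤ j) (h2 : j < hi) (hb : c.Bad τ (p j) (p (j + 1))) : c.Esc τ X (p 0) (p 1) := by
  have hl := P.len
  have hl0 := P.lo0
  have hl1 := P.hi1
  rcases le_or_gt 0 j with h0 | h0
  · obtain ⟨k, rfl⟩ := Int.eq_ofNat_of_zero_le h0
    refine ⟨k, by omega, Or.inl ?_⟩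
    apply P.bad_right k 0 le_rfl (by omega)
    rwa [zero_add]
  · obtain ⟨k, hk⟩ := Int.eq_ofNat_of_zero_le (show 0 ≤ -j by omega)
    refine ⟨k, by omega, Or.inr ?_⟩
    have := P.mirror.bad_right (τ := τ) k 0 le_rfl (by omega) (by
      rw [Bad_mx, ← hk]
      simpa [sub_eq_add_neg, add_comm] using hb)
    simpa using this

lemma PathOK.step [Finite V] {X : ℕ} {p : ℤ → V} {lo hi : ℤ} (P : c.PathOK X p lo hi) {τ : ℝ} {m : ℤ}
    (m0 : 0 ≤ m) (mh : m + 1 < hi) (es : c.ES τ (p m) (p (m + 1)))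
    (ec : c.EC τ (p (m + 1)) (p (m + 1 + 1))) :
    ∃ p' hi', c.RhT τ (p (m + 1)) (p' (m + 1)) ∧ (∀ k, k ≠ m + 1 → p' k = p k) ∧ c.PathOK X p' lo hi' ∧
      inv (c.gg p') lo hi' + 1 ≤ inv (c.gg p) lo hi := by
  have l0 := P.lo0
  obtain ⟨⟨z, hz⟩, hlu⟩ := es
  have hru := ec.2
  have hz' := hz
  obtain ⟨s, r, g1, g2, g3, g4, g5, g6, g7⟩ := hz'
  obtain rfl : s = p m := lu_unique g1 hlu
  obtain rfl : r = p (m + 1 + 1) := ru_unique g2 hru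
  have sp := sq_para g1.1 g2.1 g3.1 g4.1 (by intro h; rw [h] at g5; exact lt_irrefl _ g5.2.2.1)
  obtain ⟨p', hp'⟩ : ∃ p', p' = Function.update p (m + 1) z := ⟨_, rfl⟩
  have pz : p' (m + 1) = z := by rw [hp', Function.update_self]
  have pn : ∀ k, k ≠ m + 1 → p' k = p k := fun k hk => by rw [hp', Function.update_of_ne hk]
  have pm : p' m = p m := pn m (by omega)
  have pr : p' (m + 1 + 1) = p (m + 1 + 1) := pn _ (by omega)
  have gs : ∀ k, c.gg p' k = c.gg p (Equiv.swap m (m + 1) k) := by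
    apply swp_eq
    · simp only [gg, pz, pm]; linarith [sp.2]
    · simp only [gg, pz, pr]; linarith [sp.2]
    · intro k h1 h2
      simp only [gg]; rw [pn k h2, pn (k + 1) (by omega)]
  have glt : c.gg p m < c.gg p (m + 1) := by
    have := g5.2.2.1
    simp only [gg]; linarith [sp.2]
  have gm : c.gg p' m = c.gg p (m + 1) := by rw [gs, Equiv.swap_apply_left]
  have gm1 : c.gg p' (m + 1) = c.gg p m := by rw [gs, Equiv.swap_apply_right]
  have hBz := B_nxt g6
  have hAz := A_nxt g5
  have hinv := inv_swp gs (by omega : lo ≤ m) mh glt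
  have edge' : ∀ i, lo ≤ i → i < hi → c.E (p' i) (p' (i + 1)) := by
    intro i h1 h2
    by_cases e1 : i = m
    · rw [e1, pz, pm]; exact g3.1
    by_cases e2 : i = m + 1
    · rw [e2, pz, pr]; exact g4.1
    rw [pn i e2, pn (i + 1) (by omega)]; exact P.edge i h1 h2
  have hA' : ∀ i, lo < i → i ≤ 0 → c.A (p' i) (p' (i + 1)) < X := by
    intro i h1 h2
    have := P.hA i h1 h2
    by_cases e1 : i = m
    · rw [e1, pz, pm]; rw [e1] at this; omega
    rw [pn i (by omega), pn (i + 1) (by omega)]; exact this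
  have firstA' : 1 + cgt (c.gg p') lo hi (c.gg p' lo) ≤ c.A (p' lo) (p' (lo + 1)) := by
    have hf := P.firstA
    rw [cgt_swp gs (by omega) mh]
    by_cases e1 : lo = m
    · have : cgt (c.gg p) lo hi (c.gg p (m + 1)) < cgt (c.gg p) lo hi (c.gg p m) := by
        apply Finset.card_lt_card
        constructor
        · intro k hk
          simp only [Finset.mem_filter] at hk ⊢
          exact ⟨hk.1, glt.trans hk.2⟩
        · intro hk
          have := hk (Finset.mem_filter.2 ⟨Finset.mem_Ico.2 ⟨by omega, mh⟩, glt⟩)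
          exact lt_irrefl _ (Finset.mem_filter.1 this).2
      rw [e1] at hf this ⊢
      rw [gm, pz, pm]
      omega
    · have : c.gg p' lo = c.gg p lo := by rw [gs, Equiv.swap_apply_of_ne_of_ne e1 (by omega)]
      rw [this, pn lo (by omega), pn (lo + 1) (by omega)]
      exact hf
  by_cases hX : c.B (p m) z < X
  · refine ⟨p', hi, by rw [pz]; exact hz, pn, ⟨P.lo0, P.hi1, P.len, edge', ?_, hA', ?_, firstA'⟩, hinv⟩
    · intro i h1 h2
      by_cases e1 : i = m
      · rw [e1, pz, pm]; exact hX
      have := P.hB i h1 h2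
      by_cases e2 : i = m + 1
      · rw [e2] at this; rw [e2, pz, pr]; omega
      rw [pn i e2, pn (i + 1) (by omega)]; exact this
    · have hf := P.lastB
      rw [clt_swp gs (by omega) mh]
      by_cases e1 : hi = m + 1 + 1
      · have : clt (c.gg p) lo hi (c.gg p m) < clt (c.gg p) lo hi (c.gg p (m + 1)) := by
          apply Finset.card_lt_card
          constructor
          · intro k hk
            simp only [Finset.mem_filter] at hk ⊢
            exact ⟨hk.1, hk.2.trans glt⟩
          · intro hk
            have := hk (Finset.mem_filter.2 ⟨Finset.mem_Ico.2 ⟨by omega, by omega⟩, glt⟩)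
            exact lt_irrefl _ (Finset.mem_filter.1 this).2
        rw [e1, add_sub_cancel_right] at hf ⊢
        rw [e1] at this
        rw [gm1, pz, pr]
        omega
      · have : c.gg p' (hi - 1) = c.gg p (hi - 1) := by
          rw [gs, Equiv.swap_apply_of_ne_of_ne (by omega) (by omega)]
        rw [this, pn hi (by omega), pn (hi - 1) (by omega)]
        exact hf
  · push Not at hX
    have hl := P.len
    refine ⟨p', m + 1, by rw [pz]; exact hz, pn, ⟨P.lo0, by omega, by omega, fun i h1 h2 => edge' i h1 (by omega), ?_, hA', ?_, ?_⟩, ?_⟩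
    · intro i h1 h2
      rw [pn i (by omega), pn (i + 1) (by omega)]
      exact P.hB i h1 (by omega)
    · have := clt_le (c.gg p') (lo := lo) (hi := m + 1) (k := m + 1 - 1) (by omega) (by omega)
      rw [add_sub_cancel_right] at this ⊢
      rw [pz, pm]
      omega
    · have := cgt_mono (c.gg p') (lo := lo) (hi := hi) (hi' := m + 1) (by omega) (c.gg p' lo)
      omega
    · have := inv_mono (c.gg p') (lo := lo) (hi := hi) (hi' := m + 1) (by omega)
      omega

lemma PathOK.find [Finite V] {X : ℕ} {p : ℤ → V} {lo hi : ℤ} (P : c.PathOK X p lo hi) (τ : ℝ)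
    (hb : ∀ j, lo ≤ j → j < hi → ¬ c.Bad τ (p j) (p (j + 1))) :
    ∃ m, lo ≤ m ∧ m + 1 < hi ∧ c.ES τ (p m) (p (m + 1)) ∧ c.EC τ (p (m + 1)) (p (m + 1 + 1)) := by
  by_contra hcon
  have l0 := P.lo0
  have l1 := P.hi1
  have key : ∀ k, lo ≤ k → k < hi → c.ES τ (p k) (p (k + 1)) := by
    intro k hk
    induction k, hk using Int.leInduction with
    | base =>
      intro h
      by_contra h1
      have h2 : c.EC τ (p lo) (p (lo + 1)) := by
        by_contra h2
        exact hb lo le_rfl h ⟨P.edge _ le_rfl h, h1, h2⟩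
      have := ru_A h2.2
      have := P.firstA
      omega
    | succ k hk ih =>
      intro h
      by_contra h1
      have h2 : c.EC τ (p (k + 1)) (p (k + 1 + 1)) := by
        by_contra h2
        exact hb (k + 1) (by omega) h ⟨P.edge _ (by omega) h, h1, h2⟩
      exact hcon ⟨k, hk, h, ih (by omega), h2⟩
  have h := key (hi - 1) (by omega) (by omega)
  have h2 := lu_B h.2
  rw [sub_add_cancel] at h2
  have := P.lastB
  omega

lemma PathOK.aux [Finite V] {τ : ℝ} {X : ℕ} (N : ℕ) (ih : ∀ M < N, ∀ (c : Cfg V) (p : ℤ → V) (lo hi : ℤ),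
    c.PathOK X p lo hi → inv (c.gg p) lo hi ≤ M → c.ESC τ X M (p 0) (p 1))
    {c : Cfg V} {p : ℤ → V} {lo hi : ℤ} (P : c.PathOK X p lo hi) (hN : inv (c.gg p) lo hi ≤ N) {m : ℤ}
    (m0 : 0 ≤ m) (mh : m + 1 < hi) (es : c.ES τ (p m) (p (m + 1)))
    (ec : c.EC τ (p (m + 1)) (p (m + 1 + 1))) : c.ESC τ X N (p 0) (p 1) := by
  obtain ⟨p', hi', h1, h2, h3, h4⟩ := P.step m0 mh es ec
  obtain ⟨M, rfl⟩ : ∃ M, N = M + 1 := ⟨N - 1, by omega⟩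
  have := ih M (by omega) c p' lo hi' h3 (by omega)
  rw [h2 0 (by omega)] at this
  by_cases hm : m = 0
  · subst hm
    exact Or.inr (Or.inr ⟨p' 1, h1, this⟩)
  · rw [h2 1 (by omega)] at this
    exact Or.inl this

lemma PathOK.main [Finite V] {τ : ℝ} {X : ℕ} (N : ℕ) : ∀ (c : Cfg V) (p : ℤ → V) (lo hi : ℤ),
    c.PathOK X p lo hi → inv (c.gg p) lo hi ≤ N → c.ESC τ X N (p 0) (p 1) := by
  induction N using Nat.strong_induction_on with
  | _ N ih =>
    intro c p lo hi P hN
    by_cases hb : ∀ j, lo ≤ j → j < hi → ¬ c.Bad τ (p j) (p (j + 1))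
    · obtain ⟨m, h1, h2, h3, h4⟩ := P.find τ hb
      rcases le_or_gt 0 m with m0 | m0
      · exact PathOK.aux N ih P hN m0 h2 h3 h4
      · have hN' := inv_neg' (gg_mx (c := c) p) lo hi
        rw [← hN'] at hN
        have e1 : 1 - (-m - 1) = m + 1 + 1 := by ring
        have e2 : 1 - (-m - 1 + 1) = m + 1 := by ring
        have e3 : 1 - (-m - 1 + 1 + 1) = m := by ring
        have := PathOK.aux N ih P.mirror hN (m := -m - 1) (by omega) (by omega)
          (by rw [ES_mx, e1, e2]; exact h4) (by rw [EC_mx, e2, e3]; exact h3)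
        rw [← ESC_mx]
        simpa using this
    · push Not at hb
      obtain ⟨j, h1, h2, h3⟩ := hb
      exact ESC_zero (P.bad_esc h1 h2 h3) N

lemma RPath.len {X : ℕ} {f : ℕ → V} {n : ℕ} (h : c.RPath X f n) :
    ∀ i ≤ n, 0.6 * (i : ℝ) ≤ c.x (f (i + 1)) - c.x (f 1) := by
  intro i
  induction i with
  | zero => intro _; simp
  | succ i ih =>
    intro hi
    have := ih (by omega)
    have := (h.1 (i + 1) (by omega)).2
    push_cast; linarith

lemma near_ESC [Finite V] {τ : ℝ} {X : ℕ} (hτ : τ ≤ 0.032) (hτ0 : 0 < τ) (hX : 1 ≤ X)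
    (hXτ : (X : ℝ) ^ 2 * (1.01 * τ) ≤ 0.092) (hd : ∀ u v, c.x v - c.x u < 0.6 * (X + 1))
    {a b : V} (e : c.E a b) (hy : (c.y b - c.y a) ^ 2 ≤ 1 / 2) : c.ESC τ X (X * (X - 1) / 2) a b := by
  by_cases hre : ∀ k < X, ¬ c.RE τ X k a b
  swap
  · push Not at hre
    obtain ⟨k, hk, h⟩ := hre
    exact ESC_zero ⟨k, hk, Or.inl h⟩ _
  by_cases hre' : ∀ k < X, ¬ c.mx.RE τ X k b a
  swap
  · push Not at hre'
    obtain ⟨k, hk, h⟩ := hre'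
    exact ESC_zero ⟨k, hk, Or.inr h⟩ _
  obtain ⟨f, n, f0, f1, hf⟩ := extend' hτ hτ0 hX hXτ hd e hy hre
  obtain ⟨f', n', f0', f1', hf'⟩ := extend' (c := c.mx) (a := b) (b := a) hτ hτ0 hX hXτ
    (fun u v => by have := hd v u; simp only [x_mx]; linarith) (E_mx.2 e)
    (by simp only [y_mx]; nlinarith) hre'
  have L1 := hf.len n le_rfl
  have L2 := hf'.len n' le_rfl
  have L3 := (hf.1 0 (Nat.zero_le _)).2
  rw [f1', x_mx, x_mx] at L2
  rw [f1] at L1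
  rw [zero_add, f1, f0] at L3
  have hlen : n + n' + 1 ≤ X := by
    have := hd (f' (n' + 1)) (f (n + 1))
    have h1 : ((n + n' + 1 : ℕ) : ℝ) < ((X + 1 : ℕ) : ℝ) := by push_cast; linarith
    have h2 : n + n' + 1 < X + 1 := by exact_mod_cast h1
    omega
  let p : ℤ → V := fun k => if 0 ≤ k then f k.toNat else f' (1 - k).toNat
  have hp : ∀ k : ℕ, p k = f k := fun k => by simp [p]
  have hp' : ∀ k : ℕ, p (1 - k) = f' k := fun k => by
    rcases k with _ | _ | k
    · simpa [p, f0'] using f1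
    · simpa [p, f1'] using f0
    · simp only [p]
      rw [if_neg (by omega)]
      congr 1; omega
  have hpos : ∀ i : ℤ, 0 ≤ i → ∃ k : ℕ, i = k ∧ p i = f k ∧ p (i + 1) = f (k + 1) := by
    intro i hi
    obtain ⟨k, rfl⟩ := Int.eq_ofNat_of_zero_le hi
    exact ⟨k, rfl, hp k, by have := hp (k + 1); push_cast at this; exact this⟩
  have hneg : ∀ i : ℤ, i ≤ 0 → ∃ k : ℕ, i = - k ∧ p i = f' (k + 1) ∧ p (i + 1) = f' k := by
    intro i hi
    obtain ⟨k, hk⟩ := Int.eq_ofNat_of_zero_le (show 0 ≤ -i by omega)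
    refine ⟨k, by omega, ?_, ?_⟩
    · rw [← hp' (k + 1)]; congr 1; push_cast; omega
    · rw [← hp' k]; congr 1; omega
  have P : c.PathOK X p (-n') (n + 1) := by
    refine ⟨by omega, by omega, by omega, ?_, ?_, ?_, ?_, ?_⟩
    · intro i h1 h2
      rcases le_or_gt 0 i with h0 | h0
      · obtain ⟨k, rfl, e1, e2⟩ := hpos i h0
        rw [e1, e2]; exact (hf.1 k (by omega)).1
      · obtain ⟨k, rfl, e1, e2⟩ := hneg i h0.le
        rw [e1, e2]; exact E_mx.1 (hf'.1 k (by omega)).1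
    · intro i h1 h2
      obtain ⟨k, rfl, e1, e2⟩ := hpos i h1
      rw [e1, e2]; exact hf.2.1 k (by omega)
    · intro i h1 h2
      obtain ⟨k, rfl, e1, e2⟩ := hneg i h2
      rw [e1, e2, ← B_mx]; exact hf'.2.1 k (by omega)
    · have h1 := clt_le (c.gg p) (lo := -n') (hi := n + 1) (k := n + 1 - 1) (by omega) (by omega)
      have h2 := hf.2.2
      rw [← hp n, ← hp (n + 1)] at h2
      push_cast at h2
      rw [add_sub_cancel_right] at h1 ⊢
      omega
    · have h1 := cgt_le (c.gg p) (lo := -n') (hi := n + 1) (k := -n') (by omega) (by omega)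
      have h2 := hf'.2.2
      obtain ⟨k, ek, e1, e2⟩ := hneg (-n') (by omega)
      obtain rfl : n' = k := by omega
      rw [B_mx, ← e1, ← e2] at h2
      omega
  have := PathOK.main (τ := τ) (X * (X - 1) / 2) c p _ _ P (inv_le _ P.len)
  have q0 := hp 0
  have q1 := hp 1
  rw [f0] at q0
  rw [f1] at q1
  push_cast at q0 q1
  rwa [q0, q1] at this
end Cfg

namespace Cfg
variable {V : Type*} {c : Cfg V}

lemma near_count [Finite V] (c : Cfg V) {τ : ℝ} {X : ℕ} (hτ : τ ≤ 0.032) (hτ0 : 0 < τ) (hX : 1 ≤ X)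
    (hXτ : (X : ℝ) ^ 2 * (1.01 * τ) ≤ 0.092) (hd : ∀ u v, c.x v - c.x u < 0.6 * (X + 1)) :
    cnt (fun p : V × V => c.E p.1 p.2 ∧ (c.y p.2 - c.y p.1) ^ 2 ≤ 1 / 2) ≤
      3 ^ (X * (X - 1) / 2) * ((2 * (X + 1) * ∑ k ∈ Finset.range X, X ^ k) * cnt (c.BadP τ)) :=
  (cnt_mono fun _ h => near_ESC hτ hτ0 hX hXτ hd h.1 h.2).trans (ESC_count c τ X _)

lemma edge_count [Finite V] (c : Cfg V) : c.G.edgeSet.ncard = cnt c.EP := by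
  symm
  refine Set.ncard_congr (fun p _ => s(p.1, p.2)) ?_ ?_ ?_
  · rintro ⟨a, b⟩ h; exact h.1
  · rintro ⟨a, b⟩ ⟨a', b'⟩ h h' e
    rcases Sym2.eq_iff.1 e with ⟨h1, h2⟩ | ⟨h1, h2⟩
    · simp only at h1 h2; rw [h1, h2]
    · simp only at h1 h2; subst h1 h2
      exact absurd (E.lt h) (not_lt.2 (E.lt h').le)
  · intro e he
    induction e using Sym2.ind with
    | _ a b =>
      have hab : c.G.Adj a b := he
      rcases lt_trichotomy (c.x a) (c.x b) with h | h | h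
      · exact ⟨(a, b), ⟨hab, h⟩, rfl⟩
      · exact absurd (c.xinj h) hab.ne
      · exact ⟨(b, a), ⟨hab.symm, h⟩, Sym2.eq_swap⟩

/-- two perpendicular views of the same drawing -/
lemma two_views [Finite V] (c d : Cfg V) (hG : d.G = c.G) (hx : ∀ v, d.x v = c.y v) (hy : ∀ v, d.y v = - c.x v) :
    cnt c.EP ≤ cnt (fun p : V × V => c.E p.1 p.2 ∧ (c.y p.2 - c.y p.1) ^ 2 ≤ 1 / 2) +
      cnt (fun p : V × V => d.E p.1 p.2 ∧ (d.y p.2 - d.y p.1) ^ 2 ≤ 1 / 2) := by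
  refine (cnt_le_or (Q := fun p : V × V => c.E p.1 p.2 ∧ (c.y p.2 - c.y p.1) ^ 2 ≤ 1 / 2)
    (R := fun p : V × V => c.E p.1 p.2 ∧ (c.x p.2 - c.x p.1) ^ 2 ≤ 1 / 2) ?_).trans
    (Nat.add_le_add_left ?_ _)
  · rintro ⟨a, b⟩ h
    have := E.sq h
    rcases le_or_gt ((c.y b - c.y a) ^ 2) (1 / 2) with h1 | h1
    · exact Or.inl ⟨h, h1⟩
    · exact Or.inr ⟨h, by simp only at this ⊢; linarith⟩
  · refine cnt_rel (fun p q => q = p ∨ q = p.swap) ?_ ?_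
    · rintro ⟨a, b⟩ ⟨h, h2⟩
      have hab : d.G.Adj a b := by rw [hG]; exact h.1
      simp only at h2
      rcases lt_trichotomy (d.x a) (d.x b) with h1 | h1 | h1
      · exact ⟨(a, b), ⟨⟨hab, h1⟩, by simp only [hy]; nlinarith⟩, Or.inl rfl⟩
      · exact absurd (d.xinj h1) hab.ne
      · exact ⟨(b, a), ⟨⟨hab.symm, h1⟩, by simp only [hy]; nlinarith⟩, Or.inr rfl⟩
    · rintro ⟨a, b⟩ ⟨a', b'⟩ q ⟨h, -⟩ ⟨h', -⟩ h1 h2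
      have l1 := h.lt
      have l2 := h'.lt
      simp only at l1 l2
      rcases h1 with rfl | rfl <;> rcases h2 with h2 | h2 <;>
        simp only [Prod.swap_prod_mk, Prod.mk.injEq] at h2 <;> obtain ⟨rfl, rfl⟩ := h2
      · rfl
      · linarith
      · linarith
      · rfl

end Cfg

lemma K_bound {X : ℕ} (hX : 1 ≤ X) {s : ℝ} (h4 : 4 ≤ s) (hs : 1.44 * (X : ℝ) ^ 2 ≤ s) :
    ((3 ^ (X * (X - 1) / 2) * (2 * (X + 1) * ∑ k ∈ Finset.range X, X ^ k) : ℕ) : ℝ) ≤ 0.15 * (3 : ℝ) ^ s := by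
  have red : ∀ (K m : ℕ), (m : ℝ) ≤ 2 * s → (K : ℝ) ^ 2 ≤ 0.0225 * 3 ^ m → (K : ℝ) ≤ 0.15 * (3 : ℝ) ^ s := by
    intro K m h1 h2
    have h3 : (3 : ℝ) ^ m ≤ ((3 : ℝ) ^ s) ^ 2 := by
      rw [← Real.rpow_natCast, ← Real.rpow_natCast ((3 : ℝ) ^ s), ← Real.rpow_mul (by norm_num)]
      apply Real.rpow_le_rpow_of_exponent_le (by norm_num)
      push_cast; linarith
    apply abs_le_of_sq_le_sq' _ (by positivity) |>.2
    rw [mul_pow]; nlinarith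
  rcases (by omega : X = 1 ∨ X = 2 ∨ 3 ≤ X) with rfl | rfl | hX3
  · exact red _ 8 (by push_cast; linarith) (by norm_num [Finset.sum_range_succ])
  · exact red _ 11 (by push_cast; norm_num at hs; linarith) (by norm_num [Finset.sum_range_succ])
  · have hX3' : (3 : ℝ) ≤ X := by exact_mod_cast hX3
    apply red _ (2 * X ^ 2 + 5)
    · push_cast; nlinarith
    · have a1 : X ^ 2 ≤ 3 ^ X ∧ (X + 1) ^ 2 ≤ 3 ^ X := by
        clear red hs hX hX3'
        induction X, hX3 using Nat.le_induction with
        | base => norm_num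
        | succ n hn ih => rw [pow_succ 3]; constructor <;> nlinarith [ih.1, ih.2]
      have a2 : ∑ k ∈ Finset.range X, X ^ k ≤ X ^ X := by
        calc _ ≤ ∑ k ∈ Finset.range X, X ^ (X - 1) := by
              apply Finset.sum_le_sum
              intro k hk
              have := Finset.mem_range.1 hk
              exact Nat.pow_le_pow_right (by omega) (by omega)
          _ = X * X ^ (X - 1) := by simp
          _ = X ^ X := by rw [← pow_succ']; congr 1; omega
      have a3 : (3 ^ (X * (X - 1) / 2)) ^ 2 * 3 ^ X ≤ 3 ^ (X ^ 2) := by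
        rw [← pow_mul, ← pow_add]
        apply Nat.pow_le_pow_right (by norm_num)
        have := Nat.div_mul_le_self (X * (X - 1)) 2
        have e : X * (X - 1) + X = X ^ 2 := by
          obtain ⟨k, rfl⟩ : ∃ k, X = k + 1 := ⟨X - 1, by omega⟩
          simp; ring
        omega
      have a4 : (X ^ X) ^ 2 ≤ 3 ^ (X ^ 2) := by
        calc (X ^ X) ^ 2 = (X ^ 2) ^ X := by rw [← pow_mul, ← pow_mul, mul_comm]
          _ ≤ (3 ^ X) ^ X := Nat.pow_le_pow_left a1.1 _
          _ = _ := by rw [← pow_mul, sq]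
      have a5 : (3 ^ (X * (X - 1) / 2) * (2 * (X + 1) * ∑ k ∈ Finset.range X, X ^ k)) ^ 2 ≤
          4 * (3 ^ (X ^ 2) * 3 ^ (X ^ 2)) := by
        calc _ ≤ (3 ^ (X * (X - 1) / 2) * (2 * (X + 1) * X ^ X)) ^ 2 := by gcongr
          _ = 4 * ((3 ^ (X * (X - 1) / 2)) ^ 2 * (X + 1) ^ 2 * (X ^ X) ^ 2) := by ring
          _ ≤ 4 * ((3 ^ (X * (X - 1) / 2)) ^ 2 * 3 ^ X * 3 ^ (X ^ 2)) := by
              exact Nat.mul_le_mul_left _ (Nat.mul_le_mul (Nat.mul_le_mul_left _ a1.2) a4)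
          _ ≤ _ := by gcongr
      have a6 : (((3 ^ (X * (X - 1) / 2) * (2 * (X + 1) * ∑ k ∈ Finset.range X, X ^ k) : ℕ) : ℝ)) ^ 2 ≤
          4 * (3 ^ (X ^ 2) * 3 ^ (X ^ 2)) := by exact_mod_cast a5
      refine a6.trans ?_
      rw [← pow_add, ← two_mul, pow_add]
      have : (0 : ℝ) < 3 ^ (2 * X ^ 2) := by positivity
      nlinarith

/-- the arithmetic at the end -/
lemma final_arith {E V b1 b2 t1 t2 q1 q2 r K Y : ℝ} (hr : 1 / 2 ≤ r) (hV : 0 ≤ V) (hK : 0 < K)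
    (hKY : K ≤ 0.15 * Y) (hY : 1 ≤ Y) (h1 : 2 * b1 ≤ 25 * (4 * V - 2 * E + t1) + 4 * t1 + 4 * q1)
    (h1' : 0 ≤ 4 * V - 2 * E + t1)
    (h2 : 2 * b2 ≤ 25 * (4 * V - 2 * E + t2) + 4 * t2 + 4 * q2) (h2' : 0 ≤ 4 * V - 2 * E + t2)
    (hE : E ≤ K * b1 + K * b2) (ht1 : t1 * 0.866 ≤ 8 * Real.pi * r ^ 2) (ht2 : t2 * 0.866 ≤ 8 * Real.pi * r ^ 2)
    (hq1 : q1 * (1 / (125 * r ^ 2)) ≤ 8 * Real.pi * r ^ 2)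
    (hq2 : q2 * (1 / (125 * r ^ 2)) ≤ 8 * Real.pi * r ^ 2) :
    E ≤ (2 - 1 / (20 * Y)) * V + 100 * r ^ 4 + 8 * r ^ 2 := by
  have hr0 : 0 < r := by linarith
  have hY0 : 0 < 20 * Y := by linarith
  have hi : 1 / (20 * Y) ≤ 1 / 20 := by
    apply one_div_le_one_div_of_le (by norm_num); linarith
  have r2 : 1 / 4 ≤ r ^ 2 := by nlinarith
  have r4 : r ^ 2 * (1 / 4) ≤ r ^ 4 := by nlinarith
  rcases le_or_gt E (1.5 * V) with hc | hc
  · have : 0 ≤ (1 / 2 - 1 / (20 * Y)) * V := mul_nonneg (by linarith) hV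
    nlinarith
  have hpi := Real.pi_lt_d2
  have T : ∀ t, t * 0.866 ≤ 8 * Real.pi * r ^ 2 → t ≤ 29.1 * r ^ 2 := by
    intro t ht; nlinarith
  have Q : ∀ q, q * (1 / (125 * r ^ 2)) ≤ 8 * Real.pi * r ^ 2 → q ≤ 3150 * r ^ 4 := by
    intro q hq
    rw [mul_one_div, div_le_iff₀ (by positivity)] at hq
    nlinarith [sq_nonneg r, pow_pos hr0 4]
  have T1 := T _ ht1
  have T2 := T _ ht2
  have Q1 := Q _ hq1
  have Q2 := Q _ hq2
  have hb : b1 + b2 ≤ 200 * (2 * V - E) + 104 * (29.1 * r ^ 2) + 4 * (3150 * r ^ 4) := by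
    linarith
  have key : 1.5 * V ≤ (0.15 * Y) * (200 * (2 * V - E) + 104 * (29.1 * r ^ 2) + 4 * (3150 * r ^ 4)) := by
    have e1 : 1.5 * V ≤ K * (200 * (2 * V - E) + 104 * (29.1 * r ^ 2) + 4 * (3150 * r ^ 4)) := by
      have := mul_le_mul_of_nonneg_left hb hK.le
      linarith
    refine e1.trans (mul_le_mul_of_nonneg_right hKY ?_)
    by_contra hh
    push Not at hh
    nlinarith
  have k2 : 1 / (20 * Y) * V ≤ 2 * V - E + 0.52 * (29.1 * r ^ 2) + 0.02 * (3150 * r ^ 4) := by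
    rw [one_div_mul_eq_div, div_le_iff₀ hY0]
    linarith
  nlinarith

/-- planar data before a rotation -/
lemma rot_cfg {V : Type*} (G : SimpleGraph V) (x y : V → ℝ)
    (unit : ∀ u v, G.Adj u v → (x v - x u) ^ 2 + (y v - y u) ^ 2 = 1)
    (noint : ∀ w u v, G.Adj u v → ∀ t : ℝ, 0 < t → t < 1 →
      x w = x u + t * (x v - x u) → y w = y u + t * (y v - y u) → False)
    (nocross : ∀ u v a b, G.Adj u v → G.Adj a b → s(u, v) ≠ s(a, b) →
      ∀ t s : ℝ, 0 ≤ t → t ≤ 1 → 0 ≤ s → s ≤ 1 →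
      x u + t * (x v - x u) = x a + s * (x b - x a) →
      y u + t * (y v - y u) = y a + s * (y b - y a) → (t = 0 ∨ t = 1) ∧ (s = 0 ∨ s = 1))
    (α β : ℝ) (h : α ^ 2 + β ^ 2 = 1) (hinj : Function.Injective fun v => α * x v + β * y v) :
    ∃ c : Cfg V, c.G = G ∧ (∀ v, c.x v = α * x v + β * y v) ∧ (∀ v, c.y v = α * y v - β * x v) := by
  refine ⟨⟨G, fun v => α * x v + β * y v, fun v => α * y v - β * x v, hinj, ?_, ?_, ?_⟩, rfl,
    fun _ => rfl, fun _ => rfl⟩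
  · intro u v e
    linear_combination ((x v - x u) ^ 2 + (y v - y u) ^ 2) * h + unit u v e
  · intro w u v e t h0 h1 hx hy
    refine noint w u v e t h0 h1 ?_ ?_
    · linear_combination α * hx - β * hy - (x w - x u - t * (x v - x u)) * h
    · linear_combination β * hx + α * hy - (y w - y u - t * (y v - y u)) * h
  · intro u v a b e1 e2 ne t s a1 a2 a3 a4 hx hy
    refine nocross u v a b e1 e2 ne t s a1 a2 a3 a4 ?_ ?_
    · linear_combination α * hx - β * hy - (x u + t * (x v - x u) - x a - s * (x b - x a)) * h
    · linear_combination β * hx + α * hy - (y u + t * (y v - y u) - y a - s * (y b - y a)) * h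

lemma generic_dir {V : Type*} [Finite V] (x y : V → ℝ) (hne : ∀ u v, u ≠ v → x u ≠ x v ∨ y u ≠ y v) :
    ∃ α β : ℝ, α ^ 2 + β ^ 2 = 1 ∧ (Function.Injective fun v => α * x v + β * y v) ∧
      (Function.Injective fun v => (-β) * x v + α * y v) := by
  have fin : (⋃ q : V × V, {t : ℝ | q.1 ≠ q.2 ∧ ((x q.1 - x q.2) + t * (y q.1 - y q.2) = 0)} ∪
      {t : ℝ | q.1 ≠ q.2 ∧ (y q.1 - y q.2) - t * (x q.1 - x q.2) = 0}).Finite := by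
    apply Set.finite_iUnion
    rintro ⟨u, v⟩
    apply Set.Finite.union
    · apply Set.Subsingleton.finite
      rintro t ⟨n, h1⟩ t' ⟨-, h2⟩
      simp only at n h1 h2
      by_contra hh
      have h3 : (t - t') * (y u - y v) = 0 := by linear_combination h1 - h2
      have h4 : y u - y v = 0 := (mul_eq_zero.1 h3).resolve_left (sub_ne_zero.2 hh)
      rw [h4] at h1
      rcases hne u v n with h | h
      · exact h (by linarith)
      · exact h (by linarith)
    · apply Set.Subsingleton.finite
      rintro t ⟨n, h1⟩ t' ⟨-, h2⟩
      simp only at n h1 h2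
      by_contra hh
      have h3 : (t - t') * (x u - x v) = 0 := by linear_combination h2 - h1
      have h4 : x u - x v = 0 := (mul_eq_zero.1 h3).resolve_left (sub_ne_zero.2 hh)
      rw [h4] at h1
      rcases hne u v n with h | h
      · exact h (by linarith)
      · exact h (by linarith)
  obtain ⟨t, ht⟩ := fin.exists_notMem
  simp only [Set.mem_iUnion, not_exists] at ht
  have hs : 0 < Real.sqrt (1 + t ^ 2) := Real.sqrt_pos.2 (by positivity)
  have hs2 := Real.sq_sqrt (show 0 ≤ 1 + t ^ 2 by positivity)
  set S := Real.sqrt (1 + t ^ 2) with hS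
  refine ⟨1 / S, t / S, ?_, ?_, ?_⟩
  · field_simp; linarith
  · intro u v h
    by_contra hn
    refine ht (u, v) (Or.inl ⟨hn, ?_⟩)
    simp only at h ⊢
    field_simp at h
    linarith
  · intro u v h
    by_contra hn
    refine ht (u, v) (Or.inr ⟨hn, ?_⟩)
    simp only at h ⊢
    field_simp at h
    linarith

namespace Cfg

/-- the bound in coordinates, for two perpendicular generic views -/
lemma main_bound {V : Type*} [Fintype V] (c d : Cfg V) (hG : d.G = c.G) (hx : ∀ v, d.x v = c.y v)
    (hy : ∀ v, d.y v = - c.x v) {r ox oy : ℝ} (hr : 1 / 2 ≤ r)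
    (hd : ∀ v, (c.x v - ox) ^ 2 + (c.y v - oy) ^ 2 ≤ r ^ 2) :
    (c.G.edgeSet.ncard : ℝ) ≤
      (2 - 1 / (20 * (3 : ℝ) ^ (16 * r ^ 2))) * Fintype.card V + 100 * r ^ 4 + 8 * r ^ 2 := by
  have hr0 : (0 : ℝ) < r := by linarith
  have hr2 : (1 / 4 : ℝ) ≤ r ^ 2 := by nlinarith
  have hd' : ∀ v, (d.x v - oy) ^ 2 + (d.y v - (-ox)) ^ 2 ≤ r ^ 2 := by
    intro v
    rw [hx, hy]
    linarith [hd v]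
  have diam : ∀ (e : Cfg V) (px py : ℝ), (∀ v, (e.x v - px) ^ 2 + (e.y v - py) ^ 2 ≤ r ^ 2) →
      ∀ u v, e.x v - e.x u ≤ 2 * r := by
    intro e px py h u v
    have h1 := abs_le_of_sq_le_sq' (a := e.x u - px) (b := r) (by nlinarith [h u, sq_nonneg (e.y u - py)]) hr0.le
    have h2 := abs_le_of_sq_le_sq' (a := e.x v - px) (b := r) (by nlinarith [h v, sq_nonneg (e.y v - py)]) hr0.le
    linarith [h1.1, h2.2]
  obtain ⟨X, hX1, hXle, hXlt⟩ : ∃ X : ℕ, 1 ≤ X ∧ 0.6 * (X : ℝ) ≤ 2 * r ∧ 2 * r < 0.6 * ((X : ℝ) + 1) := by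
    have hnn : (0 : ℝ) ≤ 2 * r / 0.6 := by positivity
    refine ⟨⌊2 * r / 0.6⌋₊, ?_, ?_, ?_⟩
    · rw [Nat.one_le_floor_iff, le_div_iff₀ (by norm_num)]
      linarith
    · have := Nat.floor_le hnn
      rw [le_div_iff₀ (by norm_num)] at this
      linarith
    · have := Nat.lt_floor_add_one (2 * r / 0.6)
      rw [div_lt_iff₀ (by norm_num)] at this
      linarith
  have hX0 : (0 : ℝ) ≤ X := Nat.cast_nonneg X
  have hXsq : 0.36 * (X : ℝ) ^ 2 ≤ 4 * r ^ 2 := by nlinarith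
  have hp : (0 : ℝ) < 125 * r ^ 2 := by positivity
  have hτ0 : (0 : ℝ) < 1 / (125 * r ^ 2) := by positivity
  have hτ : (1 : ℝ) / (125 * r ^ 2) ≤ 0.032 := by
    rw [div_le_iff₀ hp]; nlinarith
  have hXτ : (X : ℝ) ^ 2 * (1.01 * (1 / (125 * r ^ 2))) ≤ 0.092 := by
    rw [show (X : ℝ) ^ 2 * (1.01 * (1 / (125 * r ^ 2))) = ((X : ℝ) ^ 2 * 1.01) / (125 * r ^ 2) by ring,
      div_le_iff₀ hp]
    nlinarith
  have n1 := near_count c hτ hτ0 hX1 hXτ (fun u v => (diam c ox oy hd u v).trans_lt hXlt)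
  have n2 := near_count d hτ hτ0 hX1 hXτ (fun u v => (diam d oy (-ox) hd' u v).trans_lt hXlt)
  have hEE : cnt d.EP = cnt c.EP := by rw [← edge_count, ← edge_count, hG]
  have tv := two_views c d hG hx hy
  have b1 := bad_bound c (1 / (125 * r ^ 2))
  have b2 := bad_bound d (1 / (125 * r ^ 2))
  rw [hEE] at b2
  rw [edge_count]
  have kb := K_bound (s := 16 * r ^ 2) hX1 (by linarith) (by linarith)
  have hKpos : (0 : ℝ) < ((3 ^ (X * (X - 1) / 2) * (2 * (X + 1) * ∑ k ∈ Finset.range X, X ^ k) : ℕ) : ℝ) := by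
    have : 0 < ∑ k ∈ Finset.range X, X ^ k :=
      Finset.sum_pos (fun k _ => Nat.pow_pos (by omega)) ⟨0, Finset.mem_range.2 (by omega)⟩
    exact_mod_cast (by positivity)
  refine final_arith hr (Nat.cast_nonneg _) hKpos kb (Real.one_le_rpow (by norm_num) (by positivity))
    b1.1 b1.2 b2.1 b2.2 ?_ (tt_bound c hr0.le hd) (tt_bound d hr0.le hd')
    (qq_bound c hr0.le hτ0 hd) (qq_bound d hr0.le hτ0 hd')
  rw [← mul_assoc] at n1 n2
  have := tv.trans (Nat.add_le_add n1 n2)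
  exact_mod_cast this

end Cfg

/-- **Theorem 3 (upper bound, explicit form).** For every `r > 0`, every
matchstick graph on `n` vertices contained in a closed disk of radius `r` has
at most `(2 - 1/(20·3^(16r²)))·n + 100r⁴ + 8r²` edges. -/
theorem matchstick_in_disk_upper_bound (r : ℝ) (hr : 0 < r) (n : ℕ)
    (G : SimpleGraph (Fin n)) (emb : MatchstickEmbedding G)
    (o : EuclideanSpace ℝ (Fin 2)) (hD : ∀ v, emb.pos v ∈ Metric.closedBall o r) :
    (G.edgeSet.ncard : ℝ) ≤
      (2 - 1 / (20 * (3 : ℝ) ^ (16 * r ^ 2))) * n + 100 * r ^ 4 + 8 * r ^ 2 := by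
  have hY : (1 : ℝ) ≤ (3 : ℝ) ^ (16 * r ^ 2) := Real.one_le_rpow (by norm_num) (by positivity)
  rcases lt_or_ge r (1 / 2) with hlt | hge
  · have hE : G.edgeSet = ∅ := by
      rw [Set.eq_empty_iff_forall_notMem]
      intro e
      induction e using Sym2.ind with
      | _ u v =>
        intro h
        have h1 := emb.unit u v h
        have h2 := dist_triangle_right (emb.pos u) (emb.pos v) o
        have h3 := Metric.mem_closedBall.1 (hD u)
        have h4 := Metric.mem_closedBall.1 (hD v)
        linarith
    rw [hE]
    have : (1 : ℝ) / (20 * (3 : ℝ) ^ (16 * r ^ 2)) ≤ 1 := by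
      rw [div_le_one (by positivity)]; linarith
    have h5 : (0 : ℝ) ≤ (2 - 1 / (20 * (3 : ℝ) ^ (16 * r ^ 2))) * n :=
      mul_nonneg (by linarith) (Nat.cast_nonneg _)
    have h6 : (0 : ℝ) ≤ 100 * r ^ 4 + 8 * r ^ 2 := by positivity
    simp only [Set.ncard_empty, Nat.cast_zero]
    linarith
  · have sqd : ∀ p q : EuclideanSpace ℝ (Fin 2), dist p q ^ 2 = (p 0 - q 0) ^ 2 + (p 1 - q 1) ^ 2 := by
      intro p q
      rw [EuclideanSpace.dist_eq, Real.sq_sqrt (Finset.sum_nonneg fun _ _ => sq_nonneg _), Fin.sum_univ_two,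
        Real.dist_eq, Real.dist_eq, sq_abs, sq_abs]
    have ext2 : ∀ p q : EuclideanSpace ℝ (Fin 2), p 0 = q 0 → p 1 = q 1 → p = q := by
      intro p q h0 h1
      ext i
      fin_cases i
      · exact h0
      · exact h1
    have unit : ∀ u v, G.Adj u v → (emb.pos v 0 - emb.pos u 0) ^ 2 + (emb.pos v 1 - emb.pos u 1) ^ 2 = 1 := by
      intro u v h
      rw [← sqd, dist_comm, emb.unit u v h, one_pow]
    have endp : ∀ u v, G.Adj u v → ∀ t : ℝ,
        AffineMap.lineMap (emb.pos u) (emb.pos v) t ∈ ({emb.pos u, emb.pos v} : Set _) → t = 0 ∨ t = 1 := by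
      intro u v h t ht
      have hne : emb.pos u ≠ emb.pos v := fun e => h.ne (emb.inj e)
      rcases ht with ht | ht
      · left
        have := (AffineMap.lineMap_injective ℝ hne) (a₁ := t) (a₂ := 0) (by simpa using ht)
        exact this
      · right
        have := (AffineMap.lineMap_injective ℝ hne) (a₁ := t) (a₂ := 1) (by simpa using ht)
        exact this
    have lm : ∀ (p q : EuclideanSpace ℝ (Fin 2)) (t : ℝ) (i : Fin 2),
        (AffineMap.lineMap p q t : EuclideanSpace ℝ (Fin 2)) i = p i + t * (q i - p i) := by
      intro p q t i
      simp [AffineMap.lineMap_apply]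
      ring
    obtain ⟨α, β, hab, i1, i2⟩ := generic_dir (fun v => emb.pos v 0) (fun v => emb.pos v 1) (by
      intro u v huv
      by_contra! hc
      exact huv (emb.inj (ext2 _ _ hc.1 hc.2)))
    have noint : ∀ w u v, G.Adj u v → ∀ t : ℝ, 0 < t → t < 1 →
        emb.pos w 0 = emb.pos u 0 + t * (emb.pos v 0 - emb.pos u 0) →
        emb.pos w 1 = emb.pos u 1 + t * (emb.pos v 1 - emb.pos u 1) → False := by
      intro w u v h t h0 h1 e0 e1
      apply emb.noVertexInterior w u v h
      rw [openSegment_eq_image_lineMap]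
      refine ⟨t, ⟨h0, h1⟩, ?_⟩
      apply ext2
      · rw [lm, e0]
      · rw [lm, e1]
    have nocross : ∀ u v a b, G.Adj u v → G.Adj a b → s(u, v) ≠ s(a, b) →
        ∀ t s : ℝ, 0 ≤ t → t ≤ 1 → 0 ≤ s → s ≤ 1 →
        emb.pos u 0 + t * (emb.pos v 0 - emb.pos u 0) = emb.pos a 0 + s * (emb.pos b 0 - emb.pos a 0) →
        emb.pos u 1 + t * (emb.pos v 1 - emb.pos u 1) = emb.pos a 1 + s * (emb.pos b 1 - emb.pos a 1) →
        (t = 0 ∨ t = 1) ∧ (s = 0 ∨ s = 1) := by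
      intro u v a b h1 h2 ne t s t0 t1 s0 s1 e0 e1
      have key : (AffineMap.lineMap (emb.pos u) (emb.pos v) t : EuclideanSpace ℝ (Fin 2)) =
          AffineMap.lineMap (emb.pos a) (emb.pos b) s := by
        apply ext2
        · rw [lm, lm, e0]
        · rw [lm, lm, e1]
      have hs := emb.noncross u v a b h1 h2 ne
      have hm := hs (a := AffineMap.lineMap (emb.pos u) (emb.pos v) t) (by
        rw [segment_eq_image_lineMap, segment_eq_image_lineMap]
        exact ⟨⟨t, ⟨t0, t1⟩, rfl⟩, ⟨s, ⟨s0, s1⟩, key.symm⟩⟩)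
      exact ⟨endp u v h1 t hm.1, endp a b h2 s (key ▸ hm.2)⟩
    obtain ⟨c, cG, cx, cy⟩ := rot_cfg G _ _ unit noint nocross α β hab i1
    obtain ⟨d, dG, dx, dy⟩ := rot_cfg G _ _ unit noint nocross (-β) α (by linarith) i2
    have hdisk : ∀ v, (c.x v - (α * o 0 + β * o 1)) ^ 2 + (c.y v - (α * o 1 - β * o 0)) ^ 2 ≤ r ^ 2 := by
      intro v
      have h3 := Metric.mem_closedBall.1 (hD v)
      have h4 : dist (emb.pos v) o ^ 2 ≤ r ^ 2 := pow_le_pow_left₀ dist_nonneg h3 2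
      rw [sqd] at h4
      rw [cx, cy]
      refine le_of_eq_of_le ?_ h4
      linear_combination ((emb.pos v 0 - o 0) ^ 2 + (emb.pos v 1 - o 1) ^ 2) * hab
    have := Cfg.main_bound c d (by rw [cG, dG]) (fun v => by rw [dx, cy]; ring)
      (fun v => by rw [dy, cx]; ring) hge hdisk
    rw [cG, Fintype.card_fin] at this
    exact this
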